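/- Let q be a fixed prime power and let k(n,q) denote the number of equivalence classes of GL(n,F_q) under the congruence relation a ~ b iff b = x a xᵀ for some x ∈ GL(n,F_q). Let f = 1 if q is even and f = 2 if q is odd. Then lim_{n→∞} k(2n,q)/q^n = (1/2) · ( ∏_{i=1}^{∞} (1 + q^{-i/2})^f + ∏_{i=1}^{∞} (1 + (-1)^i q^{-i/2})^f ) / ∏_{i=1}^{∞} (1 - q^{-i}), where the limits are of real numbers and the infinite products are convergent products over all integers i ≥ 1 (with q^{i/2} = (√q)^i). -/

import Mathlib

open Matrix

/-- The congruence relation on `GL(n,F)`: `a ~ b` iff `b = x a xᵀ` for some `x ∈ GL(n,F)`. -/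
def congRel {n : ℕ} {F : Type} [Field F] (a b : GL (Fin n) F) : Prop :=
  ∃ x : GL (Fin n) F, b.val = x.val * a.val * x.valᵀ

open Polynomial

section PrimaryData

variable {F : Type} [Field F] {n : ℕ} {ι κ : Type}

/-- The matrix `A` acts as multiplication by `X` on a direct sum of the cyclic modules
`F[X] / (p ^ k)`, where `(p, k)` runs over the family `c`, each `p` being monic irreducible and
each `k` being positive. -/
def HasElementaryDivisors (A : Matrix (Fin n) (Fin n) F) (c : ι → F[X] × ℕ) : Prop :=
  (∀ i, (c i).1.Monic ∧ Irreducible (c i).1 ∧ 0 < (c i).2) ∧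
    ∃ e : (Fin n → F) ≃ₗ[F] (∀ i, F[X] ⧸ Ideal.span {(c i).1 ^ (c i).2}),
      ∀ v, e (A *ᵥ v) = (X : F[X]) • e v

theorem exists_hasElementaryDivisors (A : Matrix (Fin n) (Fin n) F) :
    ∃ (ι : Type) (_ : Fintype ι) (c : ι → F[X] × ℕ), HasElementaryDivisors A c := by
  classical
  obtain ⟨ι, _, p, hp, e, ⟨E⟩⟩ := Module.equiv_directSum_of_isTorsion
    (Module.AEval.isTorsion_of_finiteDimensional F (Fin n → F) (Matrix.toLin' A))
  let c : ι → F[X] × ℕ := fun i => (normalize (p i), e i)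
  have hspan : ∀ i, Submodule.span F[X] {p i ^ e i} = Ideal.span {(c i).1 ^ (c i).2} := fun i =>
    Ideal.span_singleton_eq_span_singleton.2 ((associated_normalize (p i)).pow_pow)
  let E₁ := E ≪≫ₗ DirectSum.linearEquivFunOnFintype F[X] ι _ ≪≫ₗ
    LinearEquiv.piCongrRight fun i => Submodule.quotEquivOfEq _ _ (hspan i)
  let r : (∀ i, F[X] ⧸ Ideal.span {(c i).1 ^ (c i).2}) →ₗ[F[X]]
      (∀ i : {i // 0 < e i}, F[X] ⧸ Ideal.span {(c i).1 ^ (c i).2}) :=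
    LinearMap.pi fun i => LinearMap.proj i.1
  have hr : Function.Bijective r := by
    have hs : ∀ i, ¬ 0 < e i → Subsingleton (F[X] ⧸ Ideal.span {(c i).1 ^ (c i).2}) := by
      intro i hi
      have : e i = 0 := by omega
      simp [c, this]
    constructor
    · intro x y hxy
      ext i
      by_cases hi : 0 < e i
      · exact congrFun hxy ⟨i, hi⟩
      · have := hs i hi
        exact Subsingleton.elim _ _
    · intro y
      refine ⟨fun i => if hi : 0 < e i then y ⟨i, hi⟩ else 0, ?_⟩
      ext i
      simp [r, i.2]
  let E₂ := E₁ ≪≫ₗ LinearEquiv.ofBijective r hr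
  refine ⟨{i // 0 < e i}, inferInstance, fun i => c i, fun i => ⟨?_, ?_, i.2⟩, ?_⟩
  · exact Polynomial.monic_normalize (hp i).ne_zero
  · exact (normalize_associated (p i)).symm.irreducible (hp i)
  · refine ⟨(Module.AEval'.of (Matrix.toLin' A)) ≪≫ₗ E₂.restrictScalars F, fun v => ?_⟩
    have := Module.AEval'.X_smul_of (Matrix.toLin' A) v
    simp only [LinearEquiv.trans_apply, LinearEquiv.restrictScalars_apply, ← map_smul, this]
    simp

theorem HasElementaryDivisors.similar {A B : Matrix (Fin n) (Fin n) F} {c : ι → F[X] × ℕ}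
    (hA : HasElementaryDivisors A c) (hB : HasElementaryDivisors B c) :
    ∃ g : GL (Fin n) F, g.val * A = B * g.val := by
  obtain ⟨-, e, he⟩ := hA
  obtain ⟨-, e', he'⟩ := hB
  let L := e ≪≫ₗ e'.symm
  refine ⟨⟨LinearMap.toMatrix' L.toLinearMap, LinearMap.toMatrix' L.symm.toLinearMap, ?_, ?_⟩, ?_⟩
  · rw [← LinearMap.toMatrix'_comp]; simp
  · rw [← LinearMap.toMatrix'_comp]; simp
  · apply Matrix.toLin'.injective
    ext1 i
    simp only [Matrix.toLin'_mul, Matrix.toLin'_toMatrix']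
    ext1
    simp only [LinearMap.comp_apply, Matrix.toLin'_apply, LinearEquiv.coe_coe, L,
      LinearEquiv.trans_apply, he]
    apply e'.injective
    simp [he']

theorem HasElementaryDivisors.reindex {A : Matrix (Fin n) (Fin n) F} {c : ι → F[X] × ℕ}
    {d : κ → F[X] × ℕ} (hA : HasElementaryDivisors A c) (σ : κ ≃ ι) (h : ∀ i, c (σ i) = d i) :
    HasElementaryDivisors A d := by
  obtain rfl : (fun i => c (σ i)) = d := funext h
  obtain ⟨hc, e, he⟩ := hA
  let L := LinearEquiv.piCongrLeft F[X] (fun i => F[X] ⧸ Ideal.span {(c i).1 ^ (c i).2}) σ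
  refine ⟨fun i => hc _, e ≪≫ₗ (L.symm.restrictScalars F), fun v => ?_⟩
  simp only [LinearEquiv.trans_apply, LinearEquiv.restrictScalars_apply, he, map_smul]

theorem HasElementaryDivisors.aeval_mulVec {A : Matrix (Fin n) (Fin n) F}
    {c : ι → F[X] × ℕ} {e : (Fin n → F) ≃ₗ[F] (∀ i, F[X] ⧸ Ideal.span {(c i).1 ^ (c i).2})}
    (he : ∀ v, e (A *ᵥ v) = (X : F[X]) • e v) (p : F[X]) (v : Fin n → F) :
    e (aeval A p *ᵥ v) = p • e v := by
  induction p using Polynomial.induction_on' generalizing v with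
  | add p q hp hq => 
    rw [map_add, Matrix.add_mulVec, map_add, hp, hq]
    exact (add_smul p q (e v)).symm
  | monomial k a =>
    have hk : ∀ (k : ℕ) (v : Fin n → F), e (A ^ k *ᵥ v) = (X ^ k : F[X]) • e v := by
      intro k
      induction k with
      | zero => simp
      | succ k ih => intro v; rw [pow_succ, ← Matrix.mulVec_mulVec, ih, he, smul_smul, pow_succ]
    rw [← C_mul_X_pow_eq_monomial, map_mul, map_pow, aeval_C, aeval_X, ← Matrix.mulVec_mulVec,
      mul_smul, ← hk, ← Polynomial.algebraMap_eq]
    refine Eq.trans ?_ (algebraMap_smul F[X] a (e (A ^ k *ᵥ v))).symm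
    rw [← map_smul]
    congr 1
    rw [Algebra.algebraMap_eq_smul_one, Matrix.smul_mulVec, Matrix.one_mulVec]

theorem HasElementaryDivisors.dim [Fintype ι] {A : Matrix (Fin n) (Fin n) F} {c : ι → F[X] × ℕ}
    (hA : HasElementaryDivisors A c) : ∑ i, (c i).2 * (c i).1.natDegree = n := by
  obtain ⟨hc, e, he⟩ := hA
  have h1 := e.finrank_eq
  have hne : ∀ i, (c i).1 ^ (c i).2 ≠ 0 := fun i => pow_ne_zero _ (hc i).2.1.ne_zero
  have : ∀ i, Module.Finite F (F[X] ⧸ Ideal.span {(c i).1 ^ (c i).2}) := fun i =>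
    (((hc i).1.pow (c i).2)).finite_quotient
  rw [Module.finrank_fin_fun, Module.finrank_pi_fintype] at h1
  rw [h1]
  refine Finset.sum_congr rfl fun i _ => ?_
  rw [finrank_quotient_span_eq_natDegree, natDegree_pow]

theorem exists_matrix_hasElementaryDivisors [Fintype ι] {c : ι → F[X] × ℕ}
    (hc : ∀ i, (c i).1.Monic ∧ Irreducible (c i).1 ∧ 0 < (c i).2)
    (hn : ∑ i, (c i).2 * (c i).1.natDegree = n) :
    ∃ A : Matrix (Fin n) (Fin n) F, HasElementaryDivisors A c := by
  have : ∀ i, Module.Finite F (F[X] ⧸ Ideal.span {(c i).1 ^ (c i).2}) := fun i =>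
    (((hc i).1.pow (c i).2)).finite_quotient
  have hfr : Module.finrank F (∀ i, F[X] ⧸ Ideal.span {(c i).1 ^ (c i).2}) = n := by
    rw [Module.finrank_pi_fintype, ← hn]
    refine Finset.sum_congr rfl fun i _ => ?_
    rw [finrank_quotient_span_eq_natDegree, natDegree_pow]
  let e := (Module.finBasisOfFinrankEq F _ hfr).equivFun.symm
  let m : (∀ i, F[X] ⧸ Ideal.span {(c i).1 ^ (c i).2}) →ₗ[F]
      (∀ i, F[X] ⧸ Ideal.span {(c i).1 ^ (c i).2}) := LinearMap.lsmul F[X] _ X |>.restrictScalars F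
  refine ⟨LinearMap.toMatrix' (e.symm.toLinearMap ∘ₗ m ∘ₗ e.toLinearMap), hc, e, fun v => ?_⟩
  rw [← Matrix.toLin'_apply, Matrix.toLin'_toMatrix']
  simp [m]

end PrimaryData

section KernelCount

variable {F : Type} [Field F]

theorem smul_quotient_mk_eq_zero_iff (g p a : F[X]) :
    p • Ideal.Quotient.mk (Ideal.span {g}) a = 0 ↔ g ∣ p * a := by
  rw [← Ideal.mem_span_singleton, ← Ideal.Quotient.eq_zero_iff_mem]
  rfl

theorem natCard_pow_smul_eq_zero_of_isCoprime {p g : F[X]} (h : IsCoprime p g) (k : ℕ) :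
    Nat.card {w : F[X] ⧸ Ideal.span {g} // p ^ k • w = 0} = 1 := by
  rw [Nat.card_eq_one_iff_unique]
  refine ⟨⟨fun x y => Subtype.ext ?_⟩, ⟨⟨0, smul_zero _⟩⟩⟩
  have hz : ∀ w : F[X] ⧸ Ideal.span {g}, p ^ k • w = 0 → w = 0 := by
    intro w
    obtain ⟨a, rfl⟩ := Ideal.Quotient.mk_surjective w
    rw [smul_quotient_mk_eq_zero_iff, Ideal.Quotient.eq_zero_iff_mem, Ideal.mem_span_singleton]
    exact h.symm.pow_right.dvd_of_dvd_mul_left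
  rw [hz _ x.2, hz _ y.2]

variable [Fintype F] {n : ℕ} {ι κ : Type}

theorem natCard_quotient_span_singleton {g : F[X]} (hg : g.Monic) :
    Nat.card (F[X] ⧸ Ideal.span {g}) = Fintype.card F ^ g.natDegree := by
  have : Module.Finite F (F[X] ⧸ Ideal.span {g}) := hg.finite_quotient
  rw [Module.natCard_eq_pow_finrank (K := F), finrank_quotient_span_eq_natDegree,
    Nat.card_eq_fintype_card]

theorem natCard_pow_smul_eq_zero_self {p : F[X]} (hp : p.Monic) (k e : ℕ) :
    Nat.card {w : F[X] ⧸ Ideal.span {p ^ e} // p ^ k • w = 0} =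
      Fintype.card F ^ (min k e * p.natDegree) := by
  rcases le_total e k with h | h
  · rw [min_eq_right h, ← natDegree_pow, ← natCard_quotient_span_singleton (hp.pow e)]
    refine Nat.card_congr (Equiv.subtypeUnivEquiv fun w => ?_)
    obtain ⟨a, rfl⟩ := Ideal.Quotient.mk_surjective w
    rw [smul_quotient_mk_eq_zero_iff]
    exact (pow_dvd_pow p h).mul_right a
  · rw [min_eq_left h, ← natDegree_pow, ← natCard_quotient_span_singleton (hp.pow k)]
    let f : F[X] →ₗ[F[X]] F[X] ⧸ Ideal.span {p ^ e} :=
      (Ideal.span {p ^ e}).mkQ ∘ₗ LinearMap.lsmul F[X] F[X] (p ^ (e - k))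
    have hpe : p ^ e = p ^ (e - k) * p ^ k := by rw [← pow_add]; congr 1; omega
    have hf : ∀ a, f a = Ideal.Quotient.mk _ (p ^ (e - k) * a) := fun a => rfl
    have hker : LinearMap.ker f = Ideal.span {p ^ k} := by
      ext a
      rw [LinearMap.mem_ker, hf, Ideal.Quotient.eq_zero_iff_mem, Ideal.mem_span_singleton,
        Ideal.mem_span_singleton, hpe, mul_dvd_mul_iff_left (pow_ne_zero _ hp.ne_zero)]
    have hrange : ∀ w, p ^ k • w = 0 ↔ w ∈ LinearMap.range f := by
      intro w
      obtain ⟨a, rfl⟩ := Ideal.Quotient.mk_surjective w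
      have : p ^ e ∣ p ^ k * a ↔ p ^ (e - k) ∣ a := by
        rw [hpe, mul_comm, mul_dvd_mul_iff_left (pow_ne_zero _ hp.ne_zero)]
      rw [smul_quotient_mk_eq_zero_iff, this]
      constructor
      · rintro ⟨b, rfl⟩
        exact ⟨b, hf b⟩
      · rintro ⟨b, hb⟩
        rw [hf, Ideal.Quotient.eq, Ideal.mem_span_singleton, hpe] at hb
        have := (dvd_mul_right _ _).trans hb
        exact (dvd_sub_right (dvd_mul_right _ _)).1 this
    rw [← hker]
    exact Nat.card_congr ((Equiv.subtypeEquivRight hrange).trans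
      f.quotKerEquivRange.toEquiv.symm)

open Classical in
theorem HasElementaryDivisors.natCard_ker [Fintype ι] {A : Matrix (Fin n) (Fin n) F}
    {c : ι → F[X] × ℕ} (hA : HasElementaryDivisors A c) {p : F[X]} (hp : p.Monic)
    (hi : Irreducible p) (k : ℕ) :
    Nat.card {v // aeval A (p ^ k) *ᵥ v = 0} =
      Fintype.card F ^ (p.natDegree * ∑ i, if (c i).1 = p then min k (c i).2 else 0) := by
  obtain ⟨hc, e, he⟩ := hA
  have h1 : {v // aeval A (p ^ k) *ᵥ v = 0} ≃
      ∀ i, {w : F[X] ⧸ Ideal.span {(c i).1 ^ (c i).2} // p ^ k • w = 0} :=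
    (e.toEquiv.subtypeEquiv (q := fun w => ∀ i, p ^ k • w i = 0) fun v => by
      rw [← e.map_eq_zero_iff, HasElementaryDivisors.aeval_mulVec he, funext_iff]; rfl).trans
      (Equiv.subtypePiEquivPi (p := fun i w => p ^ k • w = 0))
  rw [Nat.card_congr h1, Nat.card_pi, Finset.mul_sum, ← Finset.prod_pow_eq_pow_sum]
  refine Finset.prod_congr rfl fun i _ => ?_
  split_ifs with h
  · rw [h, natCard_pow_smul_eq_zero_self hp, mul_comm]
  · rw [mul_zero, pow_zero, natCard_pow_smul_eq_zero_of_isCoprime]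
    refine IsCoprime.pow_right ((hi.coprime_iff_not_dvd).2 fun hd => h ?_)
    exact (eq_of_monic_of_associated hp (hc i).1 (hi.associated_of_dvd (hc i).2.1 hd)).symm

theorem HasElementaryDivisors.card_fiber_eq [Fintype ι] [Fintype κ] {A B : Matrix (Fin n) (Fin n) F}
    {c : ι → F[X] × ℕ} {d : κ → F[X] × ℕ} (hA : HasElementaryDivisors A c)
    (hB : HasElementaryDivisors B d) {p r : F[X]} (hp : p.Monic) (hpi : Irreducible p)
    (hr : r.Monic) (hri : Irreducible r) (hdeg : p.natDegree = r.natDegree)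
    (h : ∀ k, Nat.card {v // aeval A (p ^ k) *ᵥ v = 0} = Nat.card {v // aeval B (r ^ k) *ᵥ v = 0})
    (k : ℕ) : Nat.card {i // c i = (p, k)} = Nat.card {i // d i = (r, k)} := by
  classical
  rcases k with - | k
  · have h1 : IsEmpty {i // c i = (p, 0)} :=
      ⟨fun i => absurd (hA.1 i).2.2 (by rw [i.2]; exact lt_irrefl _)⟩
    have h2 : IsEmpty {i // d i = (r, 0)} :=
      ⟨fun i => absurd (hB.1 i).2.2 (by rw [i.2]; exact lt_irrefl _)⟩
    simp
  have hD : ∀ k, (∑ i, if (c i).1 = p then min k (c i).2 else 0) =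
      ∑ i, if (d i).1 = r then min k (d i).2 else 0 := by
    intro k
    have := h k
    rw [hA.natCard_ker hp hpi, hB.natCard_ker hr hri, ← hdeg] at this
    exact Nat.eq_of_mul_eq_mul_left hpi.natDegree_pos
      (Nat.pow_right_injective Fintype.one_lt_card this)
  have key : ∀ {α : Type} [Fintype α] (c : α → F[X] × ℕ) (p : F[X]),
      Nat.card {i // c i = (p, k + 1)} + (∑ i, if (c i).1 = p then min (k + 2) (c i).2 else 0) +
        (∑ i, if (c i).1 = p then min k (c i).2 else 0) =
      2 * ∑ i, if (c i).1 = p then min (k + 1) (c i).2 else 0 := by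
    intro α _ c p
    rw [Nat.card_eq_fintype_card, Fintype.card_subtype, Finset.card_filter, Finset.mul_sum,
      ← Finset.sum_add_distrib, ← Finset.sum_add_distrib]
    refine Finset.sum_congr rfl fun i _ => ?_
    by_cases h1 : (c i).1 = p
    · have h2 : c i = (p, k + 1) ↔ (c i).2 = k + 1 := by
        rw [Prod.ext_iff]; simp [h1]
      simp only [h1, h2, if_true]
      split_ifs <;> omega
    · have h2 : c i ≠ (p, k + 1) := fun h => h1 (by rw [h])
      simp [h1, h2]
  have h1 := key c p
  have h2 := key d r
  rw [hD, hD, hD] at h1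
  omega

end KernelCount

section MonicMirror

variable {F : Type} [Field F] {n : ℕ}

/-- The mirror image of a polynomial (coefficients in reverse order), rescaled so that the mirror
image of a nonzero polynomial is monic. -/
noncomputable def monicMirror : F[X] →* F[X] where
  toFun p := C p.trailingCoeff⁻¹ * p.mirror
  map_one' := by simp [← C_1, mirror_C, trailingCoeff, -map_one]
  map_mul' p r := by
    rw [trailingCoeff_mul, mirror_mul_of_domain, mul_inv, C_mul]
    ring

theorem monicMirror_apply (p : F[X]) : monicMirror p = C p.trailingCoeff⁻¹ * p.mirror := rfl

theorem natDegree_monicMirror (p : F[X]) : (monicMirror p).natDegree = p.natDegree := by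
  rcases eq_or_ne p 0 with rfl | hp
  · simp [monicMirror_apply]
  · rw [monicMirror_apply, natDegree_C_mul (inv_ne_zero (trailingCoeff_nonzero_iff_nonzero.2 hp)),
      mirror_natDegree]

theorem monic_monicMirror {p : F[X]} (hp : p ≠ 0) : (monicMirror p).Monic := by
  rw [Monic, monicMirror_apply, leadingCoeff_mul, leadingCoeff_C, mirror_leadingCoeff,
    inv_mul_cancel₀ (trailingCoeff_nonzero_iff_nonzero.2 hp)]

theorem monicMirror_monicMirror {p : F[X]} (hp : p.Monic) : monicMirror (monicMirror p) = p := by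
  have h := trailingCoeff_nonzero_iff_nonzero.2 hp.ne_zero
  rw [monicMirror_apply, monicMirror_apply, mirror_mul_of_domain, mirror_C, mirror_mirror,
    trailingCoeff_mul, mirror_trailingCoeff, hp.leadingCoeff, mul_one, ← mul_assoc, ← C_mul]
  have : (C p.trailingCoeff⁻¹ : F[X]).trailingCoeff = p.trailingCoeff⁻¹ := by
    rw [trailingCoeff, natTrailingDegree_C, coeff_C_zero]
  rw [this, inv_inv, mul_inv_cancel₀ h, C_1, one_mul]

theorem irreducible_monicMirror {p : F[X]} (hp : Irreducible p) : Irreducible (monicMirror p) := by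
  let m : F[X] ≃* F[X] := ⟨mirror_involutive.toPerm, fun p r => mirror_mul_of_domain p r⟩
  have h1 : Irreducible (m p) := (MulEquiv.irreducible_iff m).2 hp
  rw [monicMirror_apply, irreducible_isUnit_mul]
  · exact h1
  · exact isUnit_C.2 (isUnit_iff_ne_zero.2
      (inv_ne_zero (trailingCoeff_nonzero_iff_nonzero.2 hp.ne_zero)))

theorem monicMirror_X : monicMirror (X : F[X]) = X := by
  rw [monicMirror_apply, mirror_X, trailingCoeff, natTrailingDegree_X, coeff_X_one, inv_one, C_1,
    one_mul]

theorem natTrailingDegree_eq_zero_of_coeff_zero_ne {p : F[X]} (h : p.coeff 0 ≠ 0) :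
    p.natTrailingDegree = 0 :=
  natTrailingDegree_eq_zero.2 (Or.inr h)

theorem coeff_monicMirror {p : F[X]} (h : p.coeff 0 ≠ 0) {i : ℕ} (hi : i ≤ p.natDegree) :
    (monicMirror p).coeff i = (p.coeff 0)⁻¹ * p.coeff (p.natDegree - i) := by
  rw [monicMirror_apply, coeff_C_mul, coeff_mirror, trailingCoeff,
    natTrailingDegree_eq_zero_of_coeff_zero_ne h, add_zero, revAt_le hi]

theorem aeval_reflect_mul_pow {S : Type} [Ring S] [Algebra F S] {a b : S} (h : b * a = 1) (N : ℕ)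
    (f : F[X]) (hf : f.natDegree ≤ N) : aeval b (reflect N f) * a ^ N = aeval a f := by
  have hba : ∀ k, b ^ k * a ^ k = 1 := by
    intro k
    induction k with
    | zero => simp
    | succ k ih => rw [pow_succ, pow_succ', mul_assoc, ← mul_assoc b, h, one_mul, ih]
  refine induction_with_natDegree_le
    (fun f => aeval b (reflect N f) * a ^ N = aeval a f) _ ?_ ?_ ?_ f hf
  · simp
  · intro n r _ hnN
    simp only [revAt_le hnN, reflect_C_mul_X_pow, map_mul, map_pow, aeval_X, aeval_C]
    conv in a ^ N => rw [← Nat.sub_add_cancel hnN]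
    rw [pow_add, ← mul_assoc, mul_assoc (algebraMap F S r), hba, mul_one]
  · intro p r _ _ hp hr
    rw [reflect_add, map_add, add_mul, hp, hr, map_add]

theorem commute_aeval {S : Type} [Ring S] [Algebra F S] {a b : S} (h : Commute b a) (p : F[X]) :
    Commute (aeval b p) a := by
  induction p using Polynomial.induction_on' with
  | add p q hp hq => rw [map_add]; exact hp.add_left hq
  | monomial k c =>
    rw [aeval_monomial]
    exact (Algebra.commute_algebraMap_left c a).mul_left (h.pow_left k)

theorem aeval_monicMirror_mulVec_eq_zero_iff {A B : Matrix (Fin n) (Fin n) F} (h : B * A = 1)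
    {p : F[X]} (hp : p.coeff 0 ≠ 0) (v : Fin n → F) :
    aeval B (monicMirror p) *ᵥ v = 0 ↔ aeval A p *ᵥ v = 0 := by
  have hc : p.trailingCoeff⁻¹ ≠ 0 :=
    inv_ne_zero (trailingCoeff_nonzero_iff_nonzero.2 fun h => hp (by simp [h]))
  have hA : IsUnit A := by
    rw [Matrix.isUnit_iff_isUnit_det]
    exact Matrix.isUnit_det_of_left_inverse h
  have hcomm : Commute (aeval B p.mirror) (A ^ p.natDegree) := by
    have h1 : Commute A B := by rw [Commute, SemiconjBy, h, mul_eq_one_comm.1 h]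
    exact (commute_aeval h1.symm _).pow_right _
  have h1 := aeval_reflect_mul_pow h p.natDegree p le_rfl
  have h2 : p.mirror = reflect p.natDegree p := by
    rw [mirror, natTrailingDegree_eq_zero_of_coeff_zero_ne hp, pow_zero, mul_one, reverse]
  rw [← h2, hcomm.eq] at h1
  rw [← h1, monicMirror_apply, map_mul, aeval_C, ← Matrix.mulVec_mulVec, ← Matrix.mulVec_mulVec,
    Algebra.algebraMap_eq_smul_one, Matrix.smul_mulVec, Matrix.one_mulVec, smul_eq_zero_iff_right hc]
  have hinj := Matrix.mulVec_injective_iff_isUnit.2 (hA.pow p.natDegree)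
  exact (hinj.eq_iff' (Matrix.mulVec_zero _)).symm

theorem natCard_ker_inv {A B : Matrix (Fin n) (Fin n) F} (h : B * A = 1) {p : F[X]}
    (hp : p.Monic) (hi : Irreducible p) (k : ℕ) :
    Nat.card {v // aeval A (p ^ k) *ᵥ v = 0} =
      Nat.card {v // aeval B (monicMirror p ^ k) *ᵥ v = 0} := by
  refine Nat.card_congr (Equiv.subtypeEquivRight fun v => ?_)
  by_cases h0 : p.coeff 0 = 0
  · have hX : p = X := by
      exact (eq_of_monic_of_associated monic_X hp
        (irreducible_X.associated_of_dvd hi (X_dvd_iff.2 h0))).symm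
    have hz : ∀ A : Matrix (Fin n) (Fin n) F, IsUnit A → (A ^ k *ᵥ v = 0 ↔ v = 0) := fun A hA =>
      (Matrix.mulVec_injective_iff_isUnit.2 (hA.pow k)).eq_iff' (Matrix.mulVec_zero _)
    rw [hX, monicMirror_X, map_pow, map_pow, aeval_X, aeval_X, hz A, hz B]
    · exact (Matrix.isUnit_iff_isUnit_det _).2 (Matrix.isUnit_det_of_right_inverse h)
    · exact (Matrix.isUnit_iff_isUnit_det _).2 (Matrix.isUnit_det_of_left_inverse h)
  · rw [← map_pow, aeval_monicMirror_mulVec_eq_zero_iff h]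
    rw [coeff_zero_eq_eval_zero, eval_pow, ← coeff_zero_eq_eval_zero]
    exact pow_ne_zero _ h0

theorem natCard_ker_transpose [Finite F] (A : Matrix (Fin n) (Fin n) F) (p : F[X]) :
    Nat.card {v // aeval A p *ᵥ v = 0} = Nat.card {v // aeval Aᵀ p *ᵥ v = 0} := by
  have hT : aeval Aᵀ p = (aeval A p)ᵀ := by
    induction p using Polynomial.induction_on' with
    | add p q hp hq => simp [hp, hq]
    | monomial k a =>
      rw [← C_mul_X_pow_eq_monomial]
      simp [Algebra.algebraMap_eq_smul_one, Matrix.transpose_pow]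
  have hcard : ∀ M : Matrix (Fin n) (Fin n) F,
      Nat.card {v // M *ᵥ v = 0} = Nat.card F ^ (n - M.rank) := by
    intro M
    have h1 := M.mulVecLin.finrank_range_add_finrank_ker
    rw [Module.finrank_fin_fun] at h1
    rw [Matrix.rank, show n - Module.finrank F M.mulVecLin.range =
      Module.finrank F M.mulVecLin.ker by omega, ← Module.natCard_eq_pow_finrank]
    rfl
  rw [hT, hcard, hcard, Matrix.rank_transpose]

end MonicMirror

section Levels

variable {F : Type} [Field F] {n : ℕ} {ι κ : Type} [Fintype ι] [Fintype κ]

theorem exists_equiv_of_natCard_fiber_eq {α : Type} {c : ι → α} {d : κ → α}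
    (h : ∀ y, Nat.card {i // c i = y} = Nat.card {i // d i = y}) :
    ∃ σ : ι ≃ κ, ∀ i, d (σ i) = c i := by
  have e : ∀ y, {i // c i = y} ≃ {i // d i = y} := fun y =>
    (Finite.card_eq.1 (h y)).some
  exact ⟨Equiv.ofFiberEquiv e, Equiv.ofFiberEquiv_map e⟩

open Classical in
/-- The product of the polynomials `p` for which `(p, k + 1)` occurs in the family `c`. -/
noncomputable def levelProd (c : ι → F[X] × ℕ) (k : ℕ) : F[X] :=
  ∏ i with (c i).2 = k + 1, (c i).1

theorem levelProd_comp_equiv {c : ι → F[X] × ℕ} {d : κ → F[X] × ℕ} (σ : ι ≃ κ)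
    (h : ∀ i, d (σ i) = c i) : levelProd c = levelProd d := by
  funext k
  refine Finset.prod_equiv σ (fun i => ?_) (fun i _ => ?_) <;> simp [h]

theorem HasElementaryDivisors.levelProd_monic {A : Matrix (Fin n) (Fin n) F} {c : ι → F[X] × ℕ}
    (hA : HasElementaryDivisors A c) (k : ℕ) : (levelProd c k).Monic :=
  monic_prod_of_monic _ _ fun i _ => (hA.1 i).1

theorem HasElementaryDivisors.le_dim {A : Matrix (Fin n) (Fin n) F} {c : ι → F[X] × ℕ}
    (hA : HasElementaryDivisors A c) (i : ι) : (c i).2 ≤ n := by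
  rw [← hA.dim]
  exact (Nat.le_mul_of_pos_right _ (hA.1 i).2.1.natDegree_pos).trans
    (Finset.single_le_sum (f := fun i => (c i).2 * (c i).1.natDegree) (fun _ _ => Nat.zero_le _)
      (Finset.mem_univ i))

theorem HasElementaryDivisors.levelProd_eq_one {A : Matrix (Fin n) (Fin n) F} {c : ι → F[X] × ℕ}
    (hA : HasElementaryDivisors A c) {k : ℕ} (hk : n ≤ k) : levelProd c k = 1 := by
  rw [levelProd, Finset.filter_eq_empty_iff.2, Finset.prod_empty]
  intro i _ h
  have := hA.le_dim i
  omega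

theorem sum_natDegree_levelProd {c : ι → F[X] × ℕ} (hc : ∀ i, (c i).1.Monic ∧ 0 < (c i).2) {N : ℕ}
    (hN : ∀ i, (c i).2 ≤ N) :
    ∑ k ∈ Finset.range N, (k + 1) * (levelProd c k).natDegree =
      ∑ i, (c i).2 * (c i).1.natDegree := by
  classical
  have h1 : ∀ k, (k + 1) * (levelProd c k).natDegree =
      ∑ i with (c i).2 - 1 = k, (c i).2 * (c i).1.natDegree := by
    intro k
    rw [levelProd, natDegree_prod_of_monic _ _ fun i _ => (hc i).1, Finset.mul_sum]
    refine Finset.sum_congr ?_ ?_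
    · ext i
      have := (hc i).2
      simp only [Finset.mem_filter, Finset.mem_univ, true_and]
      omega
    · intro i hi
      rw [Finset.mem_filter] at hi
      have := (hc i).2
      rw [show (c i).2 = k + 1 by omega]
  simp_rw [h1]
  refine Finset.sum_fiberwise_of_maps_to (fun i _ => ?_) _
  have := (hc i).2
  have := hN i
  rw [Finset.mem_range]
  omega

theorem HasElementaryDivisors.sum_natDegree_levelProd {A : Matrix (Fin n) (Fin n) F}
    {c : ι → F[X] × ℕ} (hA : HasElementaryDivisors A c) {N : ℕ} (hN : n ≤ N) :
    ∑ k ∈ Finset.range N, (k + 1) * (levelProd c k).natDegree = n := by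
  rw [_root_.sum_natDegree_levelProd (fun i => ⟨(hA.1 i).1, (hA.1 i).2.2⟩)
    fun i => (hA.le_dim i).trans hN, hA.dim]

open UniqueFactorizationMonoid in
theorem exists_equiv_of_levelProd_eq {c : ι → F[X] × ℕ} {d : κ → F[X] × ℕ}
    (hc : ∀ i, (c i).1.Monic ∧ Irreducible (c i).1 ∧ 0 < (c i).2)
    (hd : ∀ i, (d i).1.Monic ∧ Irreducible (d i).1 ∧ 0 < (d i).2)
    (h : levelProd c = levelProd d) : ∃ σ : ι ≃ κ, ∀ i, d (σ i) = c i := by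
  classical
  have key : ∀ {α : Type} [Fintype α] (c : α → F[X] × ℕ)
      (_ : ∀ i, (c i).1.Monic ∧ Irreducible (c i).1 ∧ 0 < (c i).2) (p : F[X]) (k : ℕ),
      Nat.card {i // c i = (p, k + 1)} = (normalizedFactors (levelProd c k)).count p := by
    intro α _ c hc p k
    have h1 : levelProd c k =
        ((Finset.univ.filter fun i => (c i).2 = k + 1).val.map fun i => (c i).1).prod := by
      rw [levelProd, Finset.prod]
    rw [h1, normalizedFactors_prod_eq, Multiset.map_map, Multiset.count_map,
      Nat.card_eq_fintype_card, Fintype.card_subtype, ← Finset.filter_val, Finset.card_val,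
      Finset.filter_filter]
    · congr 1
      ext i
      simp only [Function.comp, (hc i).1.normalize_eq_self, Finset.mem_filter, Prod.ext_iff]
      tauto
    · intro a ha
      obtain ⟨i, _, rfl⟩ := Multiset.mem_map.1 ha
      exact (hc i).2.1
  refine exists_equiv_of_natCard_fiber_eq ?_
  rintro ⟨p, k⟩
  rcases k with - | k
  · have h1 : IsEmpty {i // c i = (p, 0)} :=
      ⟨fun i => absurd (hc i).2.2 (by rw [i.2]; exact lt_irrefl _)⟩
    have h2 : IsEmpty {i // d i = (p, 0)} :=
      ⟨fun i => absurd (hd i).2.2 (by rw [i.2]; exact lt_irrefl _)⟩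
    simp
  · rw [key c hc, key d hd, h]

open UniqueFactorizationMonoid in
theorem exists_levelProd_eq {N : ℕ} {f : ℕ → F[X]} (hf : ∀ k, (f k).Monic)
    (hN : ∀ k, N ≤ k → f k = 1) :
    ∃ (ι : Type) (_ : Fintype ι) (c : ι → F[X] × ℕ),
      (∀ i, (c i).1.Monic ∧ Irreducible (c i).1 ∧ 0 < (c i).2) ∧ (∀ i, (c i).2 ≤ N) ∧
        levelProd c = f := by
  classical
  let l : ℕ → List F[X] := fun k => (normalizedFactors (f k)).toList
  have hl : ∀ k, ∀ p ∈ l k, p.Monic ∧ Irreducible p := by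
    intro k p hp
    rw [Multiset.mem_toList] at hp
    have hi := irreducible_of_normalized_factor p hp
    exact ⟨(normalize_eq_self_iff_monic hi.ne_zero).1 (normalize_normalized_factor p hp), hi⟩
  have hprod : ∀ k, (l k).prod = f k := by
    intro k
    rw [← Multiset.prod_coe, Multiset.coe_toList, prod_normalizedFactors_eq (hf k).ne_zero,
      (hf k).normalize_eq_self]
  let c : (Σ k : Fin N, Fin (l k).length) → F[X] × ℕ := fun i => ((l i.1).get i.2, i.1 + 1)
  refine ⟨Σ k : Fin N, Fin (l k).length, inferInstance, c, fun i => ⟨?_, ?_, Nat.succ_pos _⟩,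
    fun i => i.1.2, ?_⟩
  · exact (hl _ _ (List.get_mem _ _)).1
  · exact (hl _ _ (List.get_mem _ _)).2
  · funext k
    rw [levelProd, Finset.prod_filter, Fintype.prod_sigma]
    have h1 : ∀ j : Fin N, (∏ i : Fin (l j).length, if (c ⟨j, i⟩).2 = k + 1 then (c ⟨j, i⟩).1 else 1)
        = if (j : ℕ) = k then f k else 1 := by
      intro j
      by_cases hj : (j : ℕ) = k
      · simp only [c, hj, if_true]
        rw [← hj, ← hprod, ← List.prod_ofFn, List.ofFn_get]
      · simp [c, hj]
    simp_rw [h1]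
    by_cases hk : k < N
    · rw [Finset.prod_eq_single ⟨k, hk⟩]
      · simp
      · intro j _ hj
        rw [if_neg fun h => hj (Fin.ext h)]
      · simp
    · rw [hN k (by omega)]
      simp

end Levels

section Levels

variable {F : Type} [Field F] {n : ℕ}

/-- The `k`-th entry is the product of the polynomials `p` over all elementary divisors
`p ^ (k + 1)` of `A`. -/
noncomputable def levels (A : Matrix (Fin n) (Fin n) F) : ℕ → F[X] :=
  @levelProd F _ _ (exists_hasElementaryDivisors A).choose_spec.choose
    (exists_hasElementaryDivisors A).choose_spec.choose_spec.choose

theorem exists_levelProd_eq_levels (A : Matrix (Fin n) (Fin n) F) :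
    ∃ (ι : Type) (_ : Fintype ι) (c : ι → F[X] × ℕ),
      HasElementaryDivisors A c ∧ levelProd c = levels A :=
  ⟨_, _, _, (exists_hasElementaryDivisors A).choose_spec.choose_spec.choose_spec, rfl⟩

theorem levels_monic (A : Matrix (Fin n) (Fin n) F) (k : ℕ) : (levels A k).Monic := by
  obtain ⟨ι, _, c, hc, h⟩ := exists_levelProd_eq_levels A
  exact h ▸ hc.levelProd_monic k

theorem levels_eq_one (A : Matrix (Fin n) (Fin n) F) {k : ℕ} (hk : n ≤ k) : levels A k = 1 := by
  obtain ⟨ι, _, c, hc, h⟩ := exists_levelProd_eq_levels A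
  exact h ▸ hc.levelProd_eq_one hk

theorem sum_natDegree_levels (A : Matrix (Fin n) (Fin n) F) {N : ℕ} (hN : n ≤ N) :
    ∑ k ∈ Finset.range N, (k + 1) * (levels A k).natDegree = n := by
  obtain ⟨ι, _, c, hc, h⟩ := exists_levelProd_eq_levels A
  exact h ▸ hc.sum_natDegree_levelProd hN

variable [Fintype F] {ι κ : Type} [Fintype ι] [Fintype κ]

theorem HasElementaryDivisors.exists_equiv {A B : Matrix (Fin n) (Fin n) F}
    {c : ι → F[X] × ℕ} {d : κ → F[X] × ℕ} (hA : HasElementaryDivisors A c)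
    (hB : HasElementaryDivisors B d)
    (h : ∀ p : F[X], p.Monic → Irreducible p → ∀ k,
      Nat.card {v // aeval A (p ^ k) *ᵥ v = 0} = Nat.card {v // aeval B (p ^ k) *ᵥ v = 0}) :
    ∃ σ : ι ≃ κ, ∀ i, d (σ i) = c i := by
  refine exists_equiv_of_natCard_fiber_eq ?_
  rintro ⟨p, k⟩
  by_cases hp : p.Monic ∧ Irreducible p
  · exact hA.card_fiber_eq hB hp.1 hp.2 hp.1 hp.2 rfl (h p hp.1 hp.2) k
  · have h1 : IsEmpty {i // c i = (p, k)} :=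
      ⟨fun i => hp (by have := hA.1 i; rw [i.2] at this; exact ⟨this.1, this.2.1⟩)⟩
    have h2 : IsEmpty {i // d i = (p, k)} :=
      ⟨fun i => hp (by have := hB.1 i; rw [i.2] at this; exact ⟨this.1, this.2.1⟩)⟩
    simp

theorem levels_eq_of_natCard_ker_eq {A B : Matrix (Fin n) (Fin n) F}
    (h : ∀ p : F[X], p.Monic → Irreducible p → ∀ k,
      Nat.card {v // aeval A (p ^ k) *ᵥ v = 0} = Nat.card {v // aeval B (p ^ k) *ᵥ v = 0}) :
    levels A = levels B := by
  obtain ⟨ι, _, c, hc, h1⟩ := exists_levelProd_eq_levels A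
  obtain ⟨κ, _, d, hd, h2⟩ := exists_levelProd_eq_levels B
  obtain ⟨σ, hσ⟩ := hc.exists_equiv hd h
  rw [← h1, ← h2, levelProd_comp_equiv σ hσ]

theorem HasElementaryDivisors.levels_eq {A : Matrix (Fin n) (Fin n) F} {c : ι → F[X] × ℕ}
    (hA : HasElementaryDivisors A c) : levels A = levelProd c := by
  obtain ⟨κ, _, d, hd, h⟩ := exists_levelProd_eq_levels A
  obtain ⟨σ, hσ⟩ := hA.exists_equiv hd fun _ _ _ _ => rfl
  rw [← h, levelProd_comp_equiv σ hσ]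

theorem levels_eq_iff {A B : Matrix (Fin n) (Fin n) F} :
    levels A = levels B ↔ ∃ g : GL (Fin n) F, g.val * A = B * g.val := by
  constructor
  · intro h
    obtain ⟨ι, _, c, hc, h1⟩ := exists_levelProd_eq_levels A
    obtain ⟨κ, _, d, hd, h2⟩ := exists_levelProd_eq_levels B
    obtain ⟨σ, hσ⟩ := exists_equiv_of_levelProd_eq hc.1 hd.1 (h1.trans (h.trans h2.symm))
    exact hc.similar (hd.reindex σ hσ)
  · rintro ⟨g, hg⟩
    have hp : ∀ p : F[X], g.val * aeval A p = aeval B p * g.val := by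
      intro p
      induction p using Polynomial.induction_on' with
      | add p q hp hq => rw [map_add, map_add, mul_add, add_mul, hp, hq]
      | monomial k a =>
        have : SemiconjBy g.val A B := hg
        rw [aeval_monomial, aeval_monomial, ← mul_assoc, ← Algebra.commutes, mul_assoc, mul_assoc,
          (this.pow_right k).eq]
    refine levels_eq_of_natCard_ker_eq fun p _ _ k => ?_
    have hinj := Matrix.mulVec_injective_iff_isUnit.2 g.isUnit
    refine Nat.card_congr (Equiv.subtypeEquiv (Equiv.ofBijective (g.val *ᵥ ·)
      ⟨hinj, fun v => ⟨g⁻¹.val *ᵥ v, ?_⟩⟩) fun v => ?_)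
    · simp only [Matrix.mulVec_mulVec]
      rw [← Units.val_mul, mul_inv_cancel, Units.val_one, Matrix.one_mulVec]
    · change _ ↔ aeval B (p ^ k) *ᵥ (g.val *ᵥ v) = 0
      rw [Matrix.mulVec_mulVec, ← hp, ← Matrix.mulVec_mulVec]
      exact (hinj.eq_iff' (Matrix.mulVec_zero _)).symm

theorem levels_transpose (A : Matrix (Fin n) (Fin n) F) : levels Aᵀ = levels A :=
  levels_eq_of_natCard_ker_eq fun p _ _ k => (natCard_ker_transpose A (p ^ k)).symm

theorem levels_of_mul_eq_one {A B : Matrix (Fin n) (Fin n) F} (h : B * A = 1) (k : ℕ) :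
    levels B k = monicMirror (levels A k) := by
  obtain ⟨ι, _, c, hc, h1⟩ := exists_levelProd_eq_levels A
  obtain ⟨κ, _, d, hd, h2⟩ := exists_levelProd_eq_levels B
  let c' : ι → F[X] × ℕ := fun i => (monicMirror (c i).1, (c i).2)
  obtain ⟨σ, hσ⟩ : ∃ σ : ι ≃ κ, ∀ i, d (σ i) = c' i := by
    refine exists_equiv_of_natCard_fiber_eq ?_
    rintro ⟨p, k⟩
    by_cases hp : p.Monic ∧ Irreducible p
    · have hm := monic_monicMirror hp.1.ne_zero
      have hi := irreducible_monicMirror hp.2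
      rw [← hc.card_fiber_eq hd hm hi hp.1 hp.2 (natDegree_monicMirror p) (fun k => by
        rw [natCard_ker_inv h hm hi, monicMirror_monicMirror hp.1]) k]
      refine Nat.card_congr (Equiv.subtypeEquivRight fun i => ?_)
      simp only [c', Prod.ext_iff]
      refine and_congr_left fun _ => ⟨fun h => ?_, fun h => ?_⟩
      · rw [← h, monicMirror_monicMirror (hc.1 i).1]
      · rw [h, monicMirror_monicMirror hp.1]
    · have h1 : IsEmpty {i // c' i = (p, k)} :=
        ⟨fun i => hp (by
          have := i.2
          simp only [c', Prod.ext_iff] at this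
          rw [← this.1]
          exact ⟨monic_monicMirror (hc.1 i).1.ne_zero, irreducible_monicMirror (hc.1 i).2.1⟩)⟩
      have h2 : IsEmpty {i // d i = (p, k)} :=
        ⟨fun i => hp (by have := hd.1 i; rw [i.2] at this; exact ⟨this.1, this.2.1⟩)⟩
      simp
  rw [← h1, ← h2, ← levelProd_comp_equiv σ hσ, levelProd, levelProd, map_prod]

theorem isUnit_iff_levels_coeff_zero_ne (A : Matrix (Fin n) (Fin n) F) :
    IsUnit A ↔ ∀ k, (levels A k).coeff 0 ≠ 0 := by
  classical
  obtain ⟨ι, _, c, hc, h⟩ := exists_levelProd_eq_levels A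
  have h1 : IsUnit A ↔ Nat.card {v // aeval A ((X : F[X]) ^ 1) *ᵥ v = 0} = 1 := by
    rw [← Matrix.mulVec_injective_iff_isUnit, pow_one, aeval_X, Nat.card_eq_one_iff_unique]
    refine ⟨fun h => ⟨⟨fun x y => Subtype.ext (h (x.2.trans y.2.symm))⟩,
      ⟨⟨0, Matrix.mulVec_zero A⟩⟩⟩, fun ⟨h, _⟩ x y hxy => sub_eq_zero.1 ?_⟩
    exact congrArg Subtype.val (h.allEq
      ⟨x - y, by rw [Matrix.mulVec_sub]; exact sub_eq_zero.2 hxy⟩ ⟨0, Matrix.mulVec_zero A⟩)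
  have h2 : ∀ k, (levels A k).coeff 0 ≠ 0 ↔ ∀ i, (c i).2 = k + 1 → (c i).1.coeff 0 ≠ 0 := by
    intro k
    rw [← h, levelProd, coeff_zero_eq_eval_zero, eval_prod, Finset.prod_ne_zero_iff]
    simp [coeff_zero_eq_eval_zero]
  have h3 : ∀ i, (c i).1.coeff 0 = 0 ↔ (c i).1 = X := by
    refine fun i => ⟨fun h0 => ?_, fun h => by simp [h]⟩
    exact (eq_of_monic_of_associated monic_X (hc.1 i).1
        (irreducible_X.associated_of_dvd (hc.1 i).2.1 (X_dvd_iff.2 h0))).symm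
  rw [h1, hc.natCard_ker monic_X irreducible_X, natDegree_X, one_mul,
    Nat.pow_eq_one, or_iff_right Fintype.one_lt_card.ne', Finset.sum_eq_zero_iff]
  simp only [h2, h3, ne_eq]
  constructor
  · intro h k i hi hX
    have := h i (Finset.mem_univ i)
    rw [if_pos hX] at this
    omega
  · intro h i _
    rw [if_neg]
    exact h ((c i).2 - 1) i (by have := (hc.1 i).2.2; omega)

theorem exists_matrix_levels_eq {N : ℕ} {f : ℕ → F[X]} (hf : ∀ k, (f k).Monic)
    (hN : ∀ k, N ≤ k → f k = 1)
    (hn : ∑ k ∈ Finset.range N, (k + 1) * (f k).natDegree = n) :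
    ∃ A : Matrix (Fin n) (Fin n) F, levels A = f := by
  obtain ⟨ι, _, c, hc, hcN, h⟩ := exists_levelProd_eq hf hN
  rw [← h, sum_natDegree_levelProd (fun i => ⟨(hc i).1, (hc i).2.2⟩) hcN] at hn
  obtain ⟨A, hA⟩ := exists_matrix_hasElementaryDivisors hc hn
  exact ⟨A, hA.levels_eq.trans h⟩

end Levels

section Burnside

variable {F : Type} [Field F] {n : ℕ}

/-- Invertible matrices, acted on by `GL` through congruence. -/
def CongruenceSpace (n : ℕ) (F : Type) [Field F] : Type := GL (Fin n) F

/-- The transpose of an invertible matrix. -/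
def glTranspose (x : GL (Fin n) F) : GL (Fin n) F :=
  ⟨x.valᵀ, x⁻¹.valᵀ, by rw [← Matrix.transpose_mul]; simp [← Units.val_mul, -coe_units_inv],
    by rw [← Matrix.transpose_mul]; simp [← Units.val_mul, -coe_units_inv]⟩

theorem glTranspose_mul (x y : GL (Fin n) F) :
    glTranspose (x * y) = glTranspose y * glTranspose x :=
  Units.ext (Matrix.transpose_mul _ _)

/-- The congruence `a ↦ x a xᵀ`. -/
def congruenceBy (x a : GL (Fin n) F) : GL (Fin n) F := x * a * glTranspose x

instance : MulAction (GL (Fin n) F) (CongruenceSpace n F) where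
  smul := congruenceBy
  one_smul a := by
    have : glTranspose (1 : GL (Fin n) F) = 1 := Units.ext Matrix.transpose_one
    have h (b : GL (Fin n) F) : congruenceBy 1 b = b := by
      rw [congruenceBy, this, one_mul, mul_one]
    exact h a
  mul_smul x y a := by
    have h (b : GL (Fin n) F) : congruenceBy (x * y) b = congruenceBy x (congruenceBy y b) := by
      simp only [congruenceBy, glTranspose_mul, mul_assoc]
    exact h a

theorem natCard_quot_congRel :
    Nat.card (Quot (congRel (n := n) (F := F))) =
      Nat.card (MulAction.orbitRel.Quotient (GL (Fin n) F) (CongruenceSpace n F)) := by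
  refine Nat.card_congr (Quot.congrRight fun a b => ?_)
  have h : congRel a b ↔ ∃ x, congruenceBy x a = b :=
    exists_congr fun x => eq_comm.trans (Units.ext_iff (u := congruenceBy x a) (v := b)).symm
  rw [h]
  let a' : CongruenceSpace n F := a
  let b' : CongruenceSpace n F := b
  have hsymm : a' ∈ MulAction.orbit (GL (Fin n) F) b' ↔ b' ∈ MulAction.orbit (GL (Fin n) F) a' :=
    MulAction.mem_orbit_symm
  refine Iff.trans ?_ hsymm.symm
  exact Iff.rfl

/-- Every entry of `f` is fixed by `monicMirror`. For the levels of an invertible matrix `x` over a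
finite field this says that `x` is conjugate to its inverse. -/
def IsMirrorSymmetric (f : ℕ → F[X]) : Prop := ∀ k, monicMirror (f k) = f k

variable [Fintype F]

theorem levels_eq_iff_exists_mul_eq {x y : GL (Fin n) F} :
    levels x.val = levels y.val ↔ ∃ g : GL (Fin n) F, g * x = y * g := by
  rw [levels_eq_iff]
  exact exists_congr fun g => (Units.ext_iff (u := g * x) (v := y * g)).symm

theorem exists_congruence_fixed_iff (x : GL (Fin n) F) :
    (∃ a : GL (Fin n) F, x * a * glTranspose x = a) ↔ IsMirrorSymmetric (levels x.val) := by
  have h1 : (∃ a : GL (Fin n) F, x * a * glTranspose x = a) ↔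
      levels (glTranspose x).val = levels (x⁻¹).val := by
    rw [levels_eq_iff_exists_mul_eq]
    refine exists_congr fun g => ?_
    rw [mul_assoc, ← eq_inv_mul_iff_mul_eq]
  have h2 : levels (glTranspose x).val = levels x.val := levels_transpose x.val
  rw [h1, h2, funext_iff]
  refine forall_congr' fun k => ?_
  rw [levels_of_mul_eq_one (A := x.val) (B := x⁻¹.val) (by rw [← Units.val_mul]; simp), eq_comm]

open Classical in
theorem natCard_fixedBy (x : GL (Fin n) F) :
    Nat.card (MulAction.fixedBy (CongruenceSpace n F) x) =
      if IsMirrorSymmetric (levels x.val) then Nat.card {y : GL (Fin n) F // y * x = x * y}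
      else 0 := by
  have hfix : Nat.card (MulAction.fixedBy (CongruenceSpace n F) x) =
    Nat.card {a : GL (Fin n) F // x * a * glTranspose x = a} := rfl
  rw [hfix]
  split_ifs with h
  · obtain ⟨b, hb⟩ := (exists_congruence_fixed_iff x).2 h
    refine Nat.card_congr ((Equiv.mulRight b⁻¹).subtypeEquiv fun a => ?_)
    have hb' : b⁻¹ * x = glTranspose x⁻¹ * b⁻¹ := by
      have : glTranspose x⁻¹ = (glTranspose x)⁻¹ :=
        eq_inv_of_mul_eq_one_left (by
          rw [← glTranspose_mul, mul_inv_cancel]; exact Units.ext Matrix.transpose_one)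
      rw [this]
      nth_rewrite 1 [← hb]
      group
    have ht : glTranspose x * glTranspose x⁻¹ = 1 := by
      rw [← glTranspose_mul, inv_mul_cancel]; exact Units.ext Matrix.transpose_one
    change _ ↔ a * b⁻¹ * x = x * (a * b⁻¹)
    rw [mul_assoc a, hb', ← mul_assoc, ← mul_assoc, mul_left_inj]
    constructor
    · intro h
      nth_rewrite 1 [← h]
      rw [mul_assoc, ht, mul_one]
    · intro h
      rw [← h, mul_assoc, mul_eq_one_comm.1 ht, mul_one]
  · have : IsEmpty {a : GL (Fin n) F // x * a * glTranspose x = a} :=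
      ⟨fun a => h ((exists_congruence_fixed_iff x).1 ⟨a.1, a.2⟩)⟩
    exact Nat.card_of_isEmpty

theorem natCard_centralizer_mul_natCard_fiber (x : GL (Fin n) F) :
    Nat.card {y : GL (Fin n) F // y * x = x * y} *
      Nat.card {y : GL (Fin n) F // levels y.val = levels x.val} = Nat.card (GL (Fin n) F) := by
  have h := Nat.card_congr
    (MulAction.orbitProdStabilizerEquivGroup (ConjAct (GL (Fin n) F)) x)
  rw [Nat.card_prod, mul_comm] at h
  refine Eq.trans (congrArg₂ (· * ·) ?_ ?_) h
  · refine Nat.card_congr (ConjAct.toConjAct.toEquiv.subtypeEquiv fun y => ?_)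
    rw [MulAction.mem_stabilizer_iff]
    change _ ↔ ConjAct.toConjAct y • x = x
    rw [ConjAct.toConjAct_smul, mul_inv_eq_iff_eq_mul]
  · refine Nat.card_congr (Equiv.subtypeEquivRight fun y => ?_)
    rw [eq_comm, levels_eq_iff_exists_mul_eq]
    refine ConjAct.toConjAct.toEquiv.exists_congr fun g => ?_
    change _ ↔ ConjAct.toConjAct g • x = y
    rw [ConjAct.toConjAct_smul, mul_inv_eq_iff_eq_mul]

theorem natCard_quot_congRel_eq :
    Nat.card (Quot (congRel (n := n) (F := F))) =
      Nat.card {f : ℕ → F[X] // IsMirrorSymmetric f ∧ ∃ x : GL (Fin n) F, levels x.val = f} := by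
  classical
  have : Finite (CongruenceSpace n F) := inferInstanceAs (Finite (GL (Fin n) F))
  have := Fintype.ofFinite (CongruenceSpace n F)
  have hB := MulAction.sum_card_fixedBy_eq_card_orbits_mul_card_group
    (GL (Fin n) F) (CongruenceSpace n F)
  simp only [← Nat.card_eq_fintype_card] at hB
  rw [natCard_quot_congRel]
  refine Nat.eq_of_mul_eq_mul_right (Nat.card_pos (α := GL (Fin n) F)) (hB.symm.trans ?_)
  simp_rw [natCard_fixedBy]
  rw [← Finset.sum_filter]
  let s : Finset (GL (Fin n) F) := Finset.univ.filter fun x => IsMirrorSymmetric (levels x.val)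
  let t : Finset (ℕ → F[X]) := s.image fun x => levels x.val
  have ht : Nat.card {f : ℕ → F[X] // IsMirrorSymmetric f ∧ ∃ x : GL (Fin n) F, levels x.val = f} =
      t.card := by
    rw [← Fintype.card_coe t, ← Nat.card_eq_fintype_card]
    refine Nat.card_congr (Equiv.subtypeEquivRight fun f => ?_)
    simp only [t, s, Finset.mem_image, Finset.mem_filter, Finset.mem_univ, true_and]
    constructor
    · rintro ⟨h, x, rfl⟩
      exact ⟨x, h, rfl⟩
    · rintro ⟨x, h, rfl⟩
      exact ⟨h, x, rfl⟩
  rw [ht, ← Finset.sum_fiberwise_of_maps_to (s := s) (t := t) (g := fun x => levels x.val)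
    fun x hx => Finset.mem_image_of_mem _ hx, ← smul_eq_mul, ← Finset.sum_const]
  refine Finset.sum_congr rfl fun f hf => ?_
  obtain ⟨x, hx, rfl⟩ := Finset.mem_image.1 hf
  have hs : s.filter (fun y => levels y.val = levels x.val) =
      Finset.univ.filter fun y : GL (Fin n) F => levels y.val = levels x.val := by
    ext y
    simp only [s, Finset.mem_filter, Finset.mem_univ, true_and, and_iff_right_iff_imp]
    intro h
    rw [h]
    exact (Finset.mem_filter.1 hx).2
  have hc : Nat.card {y : GL (Fin n) F // levels y.val = levels x.val} =
      (Finset.univ.filter fun y : GL (Fin n) F => levels y.val = levels x.val).card := by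
    rw [Nat.card_eq_fintype_card, Fintype.card_subtype]
  have : Nonempty {y : GL (Fin n) F // levels y.val = levels x.val} := ⟨x, rfl⟩
  rw [hs]
  refine Nat.eq_of_mul_eq_mul_right
    (Nat.card_pos (α := {y : GL (Fin n) F // levels y.val = levels x.val})) ?_
  rw [Finset.sum_mul]
  nth_rewrite 2 [hc]
  rw [mul_comm, ← smul_eq_mul, ← Finset.sum_const]
  refine Finset.sum_congr rfl fun y hy => ?_
  rw [← natCard_centralizer_mul_natCard_fiber y, (Finset.mem_filter.1 hy).2]

end Burnside

section Counting

/-- The number of tuples of given total weight, as a coefficient of a product of power series. -/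
theorem natCard_sum_eq_coeff_prod {R : Type*} [CommSemiring R] {ι : Type*} [Fintype ι]
    {T : Type*} (w : ι → T → ℕ) [∀ i m, Finite {t // w i t = m}] (n : ℕ) :
    (Nat.card {f : ι → T // ∑ i, w i (f i) = n} : R) =
      PowerSeries.coeff n (∏ i, PowerSeries.mk fun m => (Nat.card {t // w i t = m} : R)) := by
  classical
  rw [PowerSeries.coeff_prod]
  simp only [PowerSeries.coeff_mk, ← Nat.cast_prod, ← Nat.cast_sum]
  congr 1
  let g : {f : ι → T // ∑ i, w i (f i) = n} → Finset.finsuppAntidiag (Finset.univ : Finset ι) n :=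
    fun f => ⟨Finsupp.equivFunOnFinite.symm fun i => w i (f.1 i), by
      simpa [Finset.mem_finsuppAntidiag] using f.2⟩
  have hg (l : Finset.finsuppAntidiag (Finset.univ : Finset ι) n) :
      {f // g f = l} ≃ ∀ i, {t // w i t = l.1 i} :=
    { toFun f i := ⟨f.1.1 i, by
        have := DFunLike.congr_fun (congrArg Subtype.val f.2) i
        simpa [g] using this⟩
      invFun f := ⟨⟨fun i => (f i).1, by
        rw [Finset.sum_congr rfl fun i _ => (f i).2]
        exact (Finset.mem_finsuppAntidiag.1 l.2).1⟩, by
        refine Subtype.ext (Finsupp.ext fun i => ?_)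
        simpa [g] using (f i).2⟩
      left_inv f := rfl
      right_inv f := rfl }
  rw [Nat.card_congr ((Equiv.sigmaFiberEquiv g).symm.trans (Equiv.sigmaCongrRight hg)),
    Nat.card_sigma, Finset.univ_eq_attach,
    ← Finset.sum_attach (Finset.finsuppAntidiag (Finset.univ : Finset ι) n)]
  exact Finset.sum_congr rfl fun l _ => Nat.card_pi

variable (F : Type) [Field F]

/-- Monic polynomials equal to their monic reversal. -/
abbrev SelfReciprocal : Type :=
  {p : F[X] // p.Monic ∧ p.coeff 0 ≠ 0 ∧ monicMirror p = p}

/-- Coefficient sequences of self-reciprocal polynomials of degree `e + 1`: the constant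
coefficient together with the `e` middle ones. -/
abbrev MiddleCoeffs (e : ℕ) : Type :=
  {x : F × (Fin e → F) // x.1 * x.1 = 1 ∧ ∀ i, x.2 (Fin.rev i) = x.1 * x.2 i}

variable {F}

theorem natCard_middleCoeffs_add_two (e : ℕ) :
    Nat.card (MiddleCoeffs F (e + 2)) = Nat.card F * Nat.card (MiddleCoeffs F e) := by
  rw [← Nat.card_prod]
  refine Nat.card_congr
    { toFun x := (x.1.2 0, ⟨(x.1.1, fun i => x.1.2 i.succ.castSucc), x.2.1, fun i => ?_⟩)
      invFun y := ⟨(y.2.1.1, Fin.snoc (Fin.cons y.1 y.2.1.2 : Fin (e + 1) → F) (y.2.1.1 * y.1)),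
        y.2.2.1, fun i => ?_⟩
      left_inv x := ?_
      right_inv y := ?_ }
  · change x.1.2 i.rev.succ.castSucc = _
    rw [← x.2.2, Fin.rev_castSucc, Fin.rev_succ, Fin.succ_castSucc]
  · obtain ⟨a, ⟨⟨ε, c⟩, hε, hc⟩⟩ := y
    simp only at hε hc ⊢
    induction i using Fin.lastCases with
    | last =>
      rw [Fin.rev_last, Fin.snoc_last, ← mul_assoc, hε, one_mul, ← Fin.castSucc_zero,
        Fin.snoc_castSucc, Fin.cons_zero]
    | cast i =>
      rw [Fin.rev_castSucc, Fin.snoc_castSucc, ← Fin.cons_snoc_eq_snoc_cons, Fin.cons_succ]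
      induction i using Fin.cases with
      | zero => rw [Fin.cons_zero, Fin.rev_zero, Fin.snoc_last]
      | succ i => rw [Fin.rev_succ, Fin.snoc_castSucc, Fin.cons_succ, hc]
  · obtain ⟨⟨ε, c⟩, hε, hc⟩ := x
    refine Subtype.ext (Prod.ext rfl (funext fun i => ?_))
    simp only at hc ⊢
    induction i using Fin.lastCases with
    | last => rw [Fin.snoc_last, ← hc, Fin.rev_zero]
    | cast i =>
      rw [Fin.snoc_castSucc]
      induction i using Fin.cases with
      | zero => rfl
      | succ i => rfl
  · obtain ⟨a, ⟨⟨ε, c⟩, hε, hc⟩⟩ := y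
    refine Prod.ext ?_ (Subtype.ext (Prod.ext rfl (funext fun i => ?_)))
    · simp only
      rw [← Fin.castSucc_zero, Fin.snoc_castSucc, Fin.cons_zero]
    · simp only
      rw [Fin.snoc_castSucc, Fin.cons_succ]

theorem natCard_middleCoeffs_zero [DecidableEq F] :
    Nat.card (MiddleCoeffs F 0) = if (-1 : F) = 1 then 1 else 2 := by
  have h : Nat.card (MiddleCoeffs F 0) = Nat.card ({1, -1} : Finset F) := by
    refine Nat.card_congr
      { toFun x := ⟨x.1.1, by simpa using mul_self_eq_one_iff.1 x.2.1⟩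
        invFun a := ⟨(a.1, Fin.elim0), ?_, fun i => i.elim0⟩
        left_inv x := ?_
        right_inv a := rfl }
    · have := a.2
      simp only [Finset.mem_insert, Finset.mem_singleton] at this
      exact mul_self_eq_one_iff.2 this
    · exact Subtype.ext (Prod.ext rfl (Subsingleton.elim _ _))
  rw [h, Nat.card_eq_fintype_card, Fintype.card_coe]
  split_ifs with h1
  · simp [h1]
  · exact Finset.card_pair (Ne.symm h1)

theorem natCard_middleCoeffs_one [Fintype F] [DecidableEq F] :
    Nat.card (MiddleCoeffs F 1) =
      if (-1 : F) = 1 then Fintype.card F else Fintype.card F + 1 := by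
  have hrev (i : Fin 1) : i.rev = i := Subsingleton.elim _ _
  have h : Nat.card (MiddleCoeffs F 1) =
      Nat.card {x : F × F // x.1 * x.1 = 1 ∧ x.2 = x.1 * x.2} := by
    refine Nat.card_congr (((Equiv.refl F).prodCongr (Equiv.funUnique (Fin 1) F)).subtypeEquiv
      fun x => and_congr_right fun _ => ?_)
    simp [hrev]
  rw [h]
  split_ifs with h1
  · rw [← Nat.card_eq_fintype_card]
    refine Nat.card_congr
      { toFun x := x.1.2
        invFun a := ⟨(1, a), by simp⟩
        left_inv x := ?_
        right_inv a := rfl }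
    have : x.1.1 = 1 := by
      rcases mul_self_eq_one_iff.1 x.2.1 with h | h
      · exact h
      · exact h.trans h1
    exact Subtype.ext (Prod.ext this.symm rfl)
  · rw [← Nat.card_eq_fintype_card, ← Finite.card_option]
    symm
    refine Nat.card_congr (Equiv.ofBijective
      (fun a : Option F => a.elim ⟨(-1, 0), by simp⟩ fun a => ⟨(1, a), by simp⟩) ⟨?_, ?_⟩)
    · rintro (_ | a) (_ | b) hab
      · rfl
      · exact absurd (congrArg (fun x => x.1.1) hab) h1
      · exact absurd (congrArg (fun x => x.1.1) hab).symm h1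
      · exact congrArg some (congrArg (fun x => x.1.2) hab)
    · rintro ⟨⟨ε, c⟩, hε, hc⟩
      simp only at hε hc
      rcases mul_self_eq_one_iff.1 hε with rfl | rfl
      · exact ⟨some c, rfl⟩
      · refine ⟨none, Subtype.ext (Prod.ext rfl ?_)⟩
        by_contra h0
        exact h1 (mul_right_cancel₀ (Ne.symm h0) (by simpa using hc.symm))

theorem selfReciprocal_iff_coeff {p : F[X]} {d : ℕ} (hp : p.Monic) (hd : p.natDegree = d) :
    (p.coeff 0 ≠ 0 ∧ monicMirror p = p) ↔
      p.coeff 0 * p.coeff 0 = 1 ∧ ∀ i ≤ d, p.coeff (d - i) = p.coeff 0 * p.coeff i := by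
  constructor
  · rintro ⟨h0, h⟩
    have hc (i : ℕ) (hi : i ≤ d) : p.coeff (d - i) = p.coeff 0 * p.coeff i := by
      have := coeff_monicMirror h0 (hi.trans_eq hd.symm)
      rw [h, hd] at this
      rw [this, mul_inv_cancel_left₀ h0]
    refine ⟨?_, hc⟩
    rw [← hc 0 (Nat.zero_le _), Nat.sub_zero, ← hd, hp.coeff_natDegree]
  · rintro ⟨h1, h⟩
    have h0 : p.coeff 0 ≠ 0 := left_ne_zero_of_mul_eq_one h1
    refine ⟨h0, Polynomial.ext fun i => ?_⟩
    rcases le_or_gt i d with hi | hi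
    · rw [coeff_monicMirror h0 (hi.trans_eq hd.symm), hd, h i hi, inv_mul_cancel_left₀ h0]
    · rw [coeff_eq_zero_of_natDegree_lt (hd.trans_lt hi), coeff_eq_zero_of_natDegree_lt]
      rwa [natDegree_monicMirror, hd]

theorem natCard_selfReciprocal_zero :
    Nat.card {p : SelfReciprocal F // p.1.natDegree = 0} = 1 := by
  rw [Nat.card_eq_one_iff_unique]
  refine ⟨⟨fun p r => Subtype.ext (Subtype.ext ?_)⟩,
    ⟨⟨⟨1, monic_one, by simp, map_one _⟩, natDegree_one⟩⟩⟩
  rw [p.1.2.1.natDegree_eq_zero.1 p.2, r.1.2.1.natDegree_eq_zero.1 r.2]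

theorem coeff_ofFn_snoc_cons_zero [DecidableEq F] {e : ℕ} (a b : F) (c : Fin e → F) :
    (ofFn (e + 2) (Fin.snoc (Fin.cons a c : Fin (e + 1) → F) b)).coeff 0 = a := by
  rw [ofFn_coeff_eq_val_of_lt _ (Nat.succ_pos _)]
  exact Fin.snoc_castSucc (α := fun _ => F) b _ 0

theorem coeff_ofFn_snoc_cons_succ [DecidableEq F] {e : ℕ} (a b : F) (c : Fin e → F) (i : Fin e) :
    (ofFn (e + 2) (Fin.snoc (Fin.cons a c : Fin (e + 1) → F) b)).coeff (i + 1) = c i := by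
  rw [ofFn_coeff_eq_val_of_lt _ (by omega)]
  exact Fin.snoc_castSucc (α := fun _ => F) b _ i.succ

theorem coeff_ofFn_snoc_cons_last [DecidableEq F] {e : ℕ} (a b : F) (c : Fin e → F) :
    (ofFn (e + 2) (Fin.snoc (Fin.cons a c : Fin (e + 1) → F) b)).coeff (e + 1) = b := by
  rw [ofFn_coeff_eq_val_of_lt _ (Nat.lt_succ_self _)]
  exact Fin.snoc_last (α := fun _ => F) b _

theorem natCard_selfReciprocal_succ (e : ℕ) :
    Nat.card {p : SelfReciprocal F // p.1.natDegree = e + 1} = Nat.card (MiddleCoeffs F e) := by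
  classical
  have hdeg (x : MiddleCoeffs F e) :
      (ofFn (e + 2) (Fin.snoc (Fin.cons x.1.1 x.1.2 : Fin (e + 1) → F) 1)).natDegree = e + 1 := by
    refine le_antisymm (Nat.lt_succ_iff.1 (ofFn_natDegree_lt (by omega) _))
      (le_natDegree_of_ne_zero ?_)
    rw [coeff_ofFn_snoc_cons_last]
    exact one_ne_zero
  have hmonic (x : MiddleCoeffs F e) :
      (ofFn (e + 2) (Fin.snoc (Fin.cons x.1.1 x.1.2 : Fin (e + 1) → F) 1)).Monic := by
    rw [Monic, leadingCoeff, hdeg, coeff_ofFn_snoc_cons_last]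
  refine Nat.card_congr
    { toFun p := ⟨(p.1.1.coeff 0, fun i => p.1.1.coeff (i + 1)),
        ((selfReciprocal_iff_coeff p.1.2.1 p.2).1 p.1.2.2).1, fun i => ?_⟩
      invFun x := ⟨⟨ofFn (e + 2) (Fin.snoc (Fin.cons x.1.1 x.1.2 : Fin (e + 1) → F) 1),
        hmonic x, (selfReciprocal_iff_coeff (hmonic x) (hdeg x)).2 ⟨?_, fun i hi => ?_⟩⟩, hdeg x⟩
      left_inv p := ?_
      right_inv x := ?_ }
  · rw [← ((selfReciprocal_iff_coeff p.1.2.1 p.2).1 p.1.2.2).2 _ (by omega)]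
    simp only [Fin.val_rev]
    congr 1
    omega
  · rw [coeff_ofFn_snoc_cons_zero]
    exact x.2.1
  · rcases Nat.eq_zero_or_pos i with rfl | h0
    · rw [coeff_ofFn_snoc_cons_zero, Nat.sub_zero, coeff_ofFn_snoc_cons_last, x.2.1]
    · rcases hi.eq_or_lt with rfl | h1
      · rw [Nat.sub_self, coeff_ofFn_snoc_cons_zero, coeff_ofFn_snoc_cons_last, mul_one]
      · obtain ⟨i, rfl⟩ := Nat.exists_eq_succ_of_ne_zero h0.ne'
        have hie : i < e := Nat.lt_of_succ_lt_succ h1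
        have hs := coeff_ofFn_snoc_cons_succ x.1.1 1 x.1.2 ⟨i, hie⟩
        have hr := coeff_ofFn_snoc_cons_succ x.1.1 1 x.1.2 (Fin.rev ⟨i, hie⟩)
        rw [Fin.val_rev, x.2.2] at hr
        simp only at hs hr
        rw [Nat.succ_eq_add_one, hs, coeff_ofFn_snoc_cons_zero, ← hr]
        congr 1
        omega
  · refine Subtype.ext (Subtype.ext (Polynomial.ext fun i => ?_))
    change (ofFn (e + 2) _).coeff i = p.1.1.coeff i
    rcases lt_or_ge (e + 1) i with h | h
    · rw [coeff_eq_zero_of_natDegree_lt (p.2.trans_lt h), ofFn_coeff_eq_zero_of_ge _ h]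
    · rcases h.eq_or_lt with rfl | h1
      · rw [coeff_ofFn_snoc_cons_last]
        nth_rewrite 2 [← p.2]
        exact p.1.2.1.coeff_natDegree.symm
      · rcases Nat.eq_zero_or_pos i with rfl | h0
        · rw [coeff_ofFn_snoc_cons_zero]
        · obtain ⟨i, rfl⟩ := Nat.exists_eq_succ_of_ne_zero h0.ne'
          exact coeff_ofFn_snoc_cons_succ _ 1 (fun i : Fin e => p.1.1.coeff (i + 1))
            ⟨i, Nat.lt_of_succ_lt_succ h1⟩
  · refine Subtype.ext (Prod.ext ?_ (funext fun i => ?_))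
    · exact coeff_ofFn_snoc_cons_zero _ _ _
    · exact coeff_ofFn_snoc_cons_succ _ _ _ i

end Counting

section GeneratingSeries

variable (F : Type) [Field F]

/-- The generating series of self-reciprocal polynomials by degree. -/
noncomputable def selfReciprocalSeries : PowerSeries ℝ :=
  PowerSeries.mk fun d => (Nat.card {p : SelfReciprocal F // p.1.natDegree = d} : ℝ)

variable {F}

theorem mk_natCard_mul_natDegree_eq (k : ℕ) :
    (PowerSeries.mk fun m =>
      (Nat.card {p : SelfReciprocal F // (k + 1) * p.1.natDegree = m} : ℝ)) =
      PowerSeries.expand (k + 1) k.succ_ne_zero (selfReciprocalSeries F) := by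
  ext m
  rw [PowerSeries.coeff_mk, PowerSeries.coeff_expand]
  split_ifs with h
  · obtain ⟨d, rfl⟩ := h
    rw [Nat.mul_div_cancel_left _ k.succ_pos, selfReciprocalSeries, PowerSeries.coeff_mk]
    simp only [Nat.mul_right_inj k.succ_ne_zero]
  · have : IsEmpty {p : SelfReciprocal F // (k + 1) * p.1.natDegree = m} :=
      ⟨fun p => h ⟨_, p.2.symm⟩⟩
    rw [Nat.card_of_isEmpty, Nat.cast_zero]

variable [Fintype F]

variable (F) in
theorem one_sub_mul_selfReciprocalSeries [DecidableEq F] :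
    (1 - PowerSeries.C (Fintype.card F : ℝ) * PowerSeries.X ^ 2) * selfReciprocalSeries F =
      (1 + PowerSeries.X) ^ (if (-1 : F) = 1 then 1 else 2) := by
  have h2 (f : PowerSeries ℝ) (d : ℕ) :
      PowerSeries.coeff (d + 2) (PowerSeries.X ^ 2 * f) = PowerSeries.coeff d f :=
    PowerSeries.coeff_X_pow_mul f 2 d
  have hsq : ((1 : PowerSeries ℝ) + PowerSeries.X) ^ 2 =
      1 + PowerSeries.C 2 * PowerSeries.X + PowerSeries.X ^ 2 := by
    have : PowerSeries.C (2 : ℝ) = 2 := map_ofNat _ 2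
    rw [this]
    ring
  ext d
  rw [sub_mul, one_mul, mul_assoc, map_sub, PowerSeries.coeff_C_mul]
  rcases d with _ | _ | _ | d
  · split_ifs <;> simp [selfReciprocalSeries, natCard_selfReciprocal_zero]
  · have : PowerSeries.coeff (0 + 1) (PowerSeries.X ^ 2 * selfReciprocalSeries F) = 0 := by
      rw [PowerSeries.coeff_X_pow_mul']
      simp
    rw [this, selfReciprocalSeries, PowerSeries.coeff_mk, natCard_selfReciprocal_succ,
      natCard_middleCoeffs_zero]
    split_ifs with h
    · simp [PowerSeries.coeff_one]
    · rw [hsq]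
      simp [PowerSeries.coeff_one, PowerSeries.coeff_X_pow]
  · rw [h2, selfReciprocalSeries, PowerSeries.coeff_mk, PowerSeries.coeff_mk,
      natCard_selfReciprocal_succ, natCard_selfReciprocal_zero, natCard_middleCoeffs_one]
    split_ifs with h
    · simp [PowerSeries.coeff_one, PowerSeries.coeff_X]
    · rw [hsq]
      simp [PowerSeries.coeff_one, PowerSeries.coeff_X_pow]
  · rw [h2, selfReciprocalSeries, PowerSeries.coeff_mk, PowerSeries.coeff_mk,
      natCard_selfReciprocal_succ, natCard_selfReciprocal_succ, natCard_middleCoeffs_add_two,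
      Nat.card_eq_fintype_card (α := F)]
    split_ifs with h
    · simp [PowerSeries.coeff_one, PowerSeries.coeff_X]
    · rw [hsq]
      simp [PowerSeries.coeff_one, PowerSeries.coeff_X_pow]

instance finite_mul_natDegree_eq (k m : ℕ) :
    Finite {p : SelfReciprocal F // (k + 1) * p.1.natDegree = m} := by
  refine Finite.of_injective (β := Fin (m + 1) → F) (fun p i => p.1.1.coeff i) fun p r h => ?_
  have hdeg (p : {p : SelfReciprocal F // (k + 1) * p.1.natDegree = m}) : p.1.1.natDegree ≤ m := by
    refine le_trans ?_ p.2.le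
    exact Nat.le_mul_of_pos_left _ (Nat.succ_pos k)
  refine Subtype.ext (Subtype.ext (Polynomial.ext fun i => ?_))
  rcases lt_or_ge i (m + 1) with hi | hi
  · exact congrFun h ⟨i, hi⟩
  · rw [coeff_eq_zero_of_natDegree_lt ((hdeg p).trans_lt hi),
      coeff_eq_zero_of_natDegree_lt ((hdeg r).trans_lt hi)]

theorem natCard_levels_mirrorSymmetric {n N : ℕ} (hN : n ≤ N) :
    Nat.card {f : ℕ → F[X] // IsMirrorSymmetric f ∧ ∃ x : GL (Fin n) F, levels x.val = f} =
      Nat.card {g : Fin N → SelfReciprocal F // ∑ k : Fin N, (k + 1) * (g k).1.natDegree = n} := by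
  refine Nat.card_congr
    { toFun f := ⟨fun k => ⟨f.1 k, ?_, ?_, f.2.1 k⟩, ?_⟩
      invFun g := ⟨fun k => if h : k < N then (g.1 ⟨k, h⟩).1 else 1, fun k => ?_, ?_⟩
      left_inv f := Subtype.ext (funext fun k => ?_)
      right_inv g := Subtype.ext (funext fun k => ?_) }
  · obtain ⟨f, -, x, rfl⟩ := f
    exact levels_monic _ _
  · obtain ⟨f, -, x, rfl⟩ := f
    exact (isUnit_iff_levels_coeff_zero_ne x.val).1 x.isUnit k
  · obtain ⟨f, -, x, rfl⟩ := f
    rw [Fin.sum_univ_eq_sum_range (fun k => (k + 1) * (levels x.val k).natDegree)]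
    exact sum_natDegree_levels _ hN
  · simp only
    split_ifs with h
    · exact (g.1 ⟨k, h⟩).2.2.2
    · exact map_one _
  · obtain ⟨A, hA⟩ := exists_matrix_levels_eq (n := n) (N := N)
      (f := fun k => if h : k < N then (g.1 ⟨k, h⟩).1 else 1)
      (fun k => by
        split_ifs with h
        · exact (g.1 ⟨k, h⟩).2.1
        · exact monic_one)
      (fun k hk => dif_neg hk.not_gt)
      (by
        rw [← Fin.sum_univ_eq_sum_range
          (fun k => (k + 1) * (if h : k < N then (g.1 ⟨k, h⟩).1 else 1 : F[X]).natDegree)]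
        simpa using g.2)
    have hu : IsUnit A := by
      rw [isUnit_iff_levels_coeff_zero_ne, hA]
      intro k
      simp only
      split_ifs with h
      · exact (g.1 ⟨k, h⟩).2.2.1
      · simp
    obtain ⟨x, rfl⟩ := hu
    exact ⟨x, hA⟩
  · obtain ⟨f, -, x, rfl⟩ := f
    simp only
    split_ifs with h
    · rfl
    · exact (levels_eq_one _ (hN.trans (not_lt.1 h))).symm
  · exact Subtype.ext (dif_pos k.2)

theorem natCard_quot_congRel_eq_coeff {n N : ℕ} (hN : n ≤ N) :
    (Nat.card (Quot (congRel (n := n) (F := F))) : ℝ) =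
      PowerSeries.coeff n (∏ k ∈ Finset.range N,
        PowerSeries.expand (k + 1) k.succ_ne_zero (selfReciprocalSeries F)) := by
  rw [natCard_quot_congRel_eq, natCard_levels_mirrorSymmetric hN,
    natCard_sum_eq_coeff_prod (fun (k : Fin N) (p : SelfReciprocal F) => (k + 1) * p.1.natDegree)]
  simp only [mk_natCard_mul_natDegree_eq]
  rw [Fin.prod_univ_eq_prod_range fun k =>
    PowerSeries.expand (k + 1) k.succ_ne_zero (selfReciprocalSeries F)]

end GeneratingSeries

section Evaluation

open Filter Topology

theorem hasSum_coeff_mul {P Q : PowerSeries ℝ} {t a b : ℝ}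
    (hP : HasSum (fun n => PowerSeries.coeff n P * t ^ n) a)
    (hQ : HasSum (fun n => PowerSeries.coeff n Q * t ^ n) b) :
    HasSum (fun n => PowerSeries.coeff n (P * Q) * t ^ n) (a * b) := by
  have hP' := hP.summable.norm
  have hQ' := hQ.summable.norm
  have hterm (n : ℕ) : ∑ kl ∈ Finset.HasAntidiagonal.antidiagonal n,
      PowerSeries.coeff kl.1 P * t ^ kl.1 * (PowerSeries.coeff kl.2 Q * t ^ kl.2) =
        PowerSeries.coeff n (P * Q) * t ^ n := by
    rw [PowerSeries.coeff_mul, Finset.sum_mul]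
    refine Finset.sum_congr rfl fun kl hkl => ?_
    rw [← Finset.HasAntidiagonal.mem_antidiagonal.1 hkl, pow_add]
    ring
  have hs := (summable_norm_sum_mul_antidiagonal_of_summable_norm hP' hQ').of_norm
  have ht := tsum_mul_tsum_eq_tsum_sum_antidiagonal_of_summable_norm hP' hQ'
  rw [hP.tsum_eq, hQ.tsum_eq] at ht
  rw [ht]
  simpa only [hterm] using hs.hasSum

theorem hasSum_coeff_one (t : ℝ) :
    HasSum (fun n => PowerSeries.coeff n (1 : PowerSeries ℝ) * t ^ n) 1 := by
  convert hasSum_single (f := fun n => PowerSeries.coeff n (1 : PowerSeries ℝ) * t ^ n) 0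
    fun n hn => ?_ using 1
  · simp
  · simp [PowerSeries.coeff_one, hn]

theorem hasSum_coeff_prod {ι : Type*} (s : Finset ι) {P : ι → PowerSeries ℝ} {t : ℝ} {a : ι → ℝ}
    (h : ∀ i ∈ s, HasSum (fun n => PowerSeries.coeff n (P i) * t ^ n) (a i)) :
    HasSum (fun n => PowerSeries.coeff n (∏ i ∈ s, P i) * t ^ n) (∏ i ∈ s, a i) := by
  classical
  induction s using Finset.induction_on with
  | empty => simpa using hasSum_coeff_one t
  | insert i s hi ih =>
    rw [Finset.prod_insert hi, Finset.prod_insert hi]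
    exact hasSum_coeff_mul (h i (Finset.mem_insert_self _ _))
      (ih fun j hj => h j (Finset.mem_insert_of_mem hj))

theorem hasSum_coeff_pow {P : PowerSeries ℝ} {t a : ℝ}
    (h : HasSum (fun n => PowerSeries.coeff n P * t ^ n) a) (m : ℕ) :
    HasSum (fun n => PowerSeries.coeff n (P ^ m) * t ^ n) (a ^ m) := by
  simpa using hasSum_coeff_prod (Finset.range m) fun _ _ => h

theorem hasSum_coeff_expand {P : PowerSeries ℝ} {t a : ℝ} {m : ℕ} (hm : m ≠ 0)
    (h : HasSum (fun n => PowerSeries.coeff n P * (t ^ m) ^ n) a) :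
    HasSum (fun n => PowerSeries.coeff n (PowerSeries.expand m hm P) * t ^ n) a := by
  rw [← Function.Injective.hasSum_iff (g := fun n => m * n)
    fun i j hij => Nat.eq_of_mul_eq_mul_left (Nat.pos_of_ne_zero hm) hij]
  · refine h.congr_fun fun n => ?_
    simp [PowerSeries.coeff_expand_mul, pow_mul]
  · intro n hn
    rw [PowerSeries.coeff_expand_of_not_dvd, zero_mul]
    rintro ⟨j, rfl⟩
    exact hn ⟨j, rfl⟩

theorem hasSum_coeff_one_add_X (t : ℝ) :
    HasSum (fun n => PowerSeries.coeff n (1 + PowerSeries.X : PowerSeries ℝ) * t ^ n) (1 + t) := by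
  have hX : HasSum (fun n => PowerSeries.coeff n (PowerSeries.X : PowerSeries ℝ) * t ^ n) t := by
    convert hasSum_single (f := fun n => PowerSeries.coeff n (PowerSeries.X : PowerSeries ℝ) * t ^ n)
      1 fun n hn => ?_ using 1
    · simp
    · simp [PowerSeries.coeff_X, hn]
  refine ((hasSum_coeff_one t).add hX).congr_fun fun n => ?_
  rw [map_add, add_mul]

/-- The evaluations of a monotone, coefficientwise stabilizing sequence of power series with
nonnegative coefficients converge to the evaluation of its limit. -/
theorem hasSum_coeff_of_stabilizing {A : ℕ → PowerSeries ℝ}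
    (hpos : ∀ N n, 0 ≤ PowerSeries.coeff n (A N))
    (hmono : ∀ N n, PowerSeries.coeff n (A N) ≤ PowerSeries.coeff n (A (N + 1)))
    (hstab : ∀ N n, n ≤ N → PowerSeries.coeff n (A (N + 1)) = PowerSeries.coeff n (A N))
    {t a b : ℝ} {u v : ℕ → ℝ}
    (hu : ∀ N, HasSum (fun n => PowerSeries.coeff n (A N) * |t| ^ n) (u N))
    (ha : Tendsto u atTop (𝓝 a))
    (hv : ∀ N, HasSum (fun n => PowerSeries.coeff n (A N) * t ^ n) (v N))
    (hb : Tendsto v atTop (𝓝 b)) :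
    HasSum (fun n => PowerSeries.coeff n (A n) * t ^ n) b := by
  have hstab' (n N : ℕ) (h : n ≤ N) : PowerSeries.coeff n (A N) = PowerSeries.coeff n (A n) := by
    induction N, h using Nat.le_induction with
    | base => rfl
    | succ N h ih => rw [hstab N n h, ih]
  have hle (n N : ℕ) : PowerSeries.coeff n (A N) ≤ PowerSeries.coeff n (A n) := by
    rcases le_total n N with h | h
    · exact (hstab' n N h).le
    · exact monotone_nat_of_le_succ (f := fun N => PowerSeries.coeff n (A N))
        (fun N => hmono N n) h
  obtain ⟨c, hc⟩ := ha.bddAbove_range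
  have hbound : Summable fun n => PowerSeries.coeff n (A n) * |t| ^ n := by
    refine summable_of_sum_range_le (c := c)
      (fun n => mul_nonneg (hpos n n) (pow_nonneg (abs_nonneg t) n)) fun M => ?_
    refine le_trans ?_ (hc ⟨M, rfl⟩)
    rw [Finset.sum_congr rfl fun n hn => by rw [← hstab' n M (Finset.mem_range.1 hn).le]]
    exact sum_le_hasSum _ (fun n _ => mul_nonneg (hpos M n) (pow_nonneg (abs_nonneg t) n)) (hu M)
  have hlim := tendsto_tsum_of_dominated_convergence (𝓕 := atTop)
    (f := fun N n => PowerSeries.coeff n (A N) * t ^ n)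
    (g := fun n => PowerSeries.coeff n (A n) * t ^ n) hbound
    (fun n => tendsto_const_nhds.congr' <| (eventually_ge_atTop n).mono fun N hN => by
      simp only [hstab' n N hN])
    (Eventually.of_forall fun N n => by
      rw [Real.norm_eq_abs, abs_mul, abs_pow, abs_of_nonneg (hpos N n)]
      exact mul_le_mul_of_nonneg_right (hle n N) (pow_nonneg (abs_nonneg t) n))
  simp only [fun N => (hv N).tsum_eq] at hlim
  rw [tendsto_nhds_unique hb hlim]
  refine (Summable.of_norm_bounded hbound fun n => ?_).hasSum
  rw [Real.norm_eq_abs, abs_mul, abs_pow, abs_of_nonneg (hpos n n)]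

theorem coeff_mul_nonneg {P Q : PowerSeries ℝ} (hP : ∀ n, 0 ≤ PowerSeries.coeff n P)
    (hQ : ∀ n, 0 ≤ PowerSeries.coeff n Q) (n : ℕ) : 0 ≤ PowerSeries.coeff n (P * Q) := by
  rw [PowerSeries.coeff_mul]
  exact Finset.sum_nonneg fun ij _ => mul_nonneg (hP _) (hQ _)

theorem coeff_le_coeff_mul {P Q : PowerSeries ℝ} (hP : ∀ n, 0 ≤ PowerSeries.coeff n P)
    (hQ : ∀ n, 0 ≤ PowerSeries.coeff n Q) (hQ0 : PowerSeries.coeff 0 Q = 1) (n : ℕ) :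
    PowerSeries.coeff n P ≤ PowerSeries.coeff n (P * Q) := by
  rw [PowerSeries.coeff_mul]
  refine le_trans ?_ (Finset.single_le_sum
    (f := fun ij : ℕ × ℕ => PowerSeries.coeff ij.1 P * PowerSeries.coeff ij.2 Q)
    (a := (n, 0)) (fun ij _ => mul_nonneg (hP _) (hQ _))
    (Finset.HasAntidiagonal.mem_antidiagonal.2 (add_zero n)))
  simp only [hQ0, mul_one, le_refl]

theorem coeff_expand_nonneg {P : PowerSeries ℝ} (hP : ∀ n, 0 ≤ PowerSeries.coeff n P) {m : ℕ}
    (hm : m ≠ 0) (n : ℕ) : 0 ≤ PowerSeries.coeff n (PowerSeries.expand m hm P) := by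
  rw [PowerSeries.coeff_expand]
  split_ifs
  · exact hP _
  · exact le_rfl

theorem coeff_mul_expand_of_lt {P Q : PowerSeries ℝ} (hQ : PowerSeries.coeff 0 Q = 1) {m n : ℕ}
    (hm : m ≠ 0) (h : n < m) :
    PowerSeries.coeff n (P * PowerSeries.expand m hm Q) = PowerSeries.coeff n P := by
  rw [PowerSeries.coeff_mul, Finset.sum_eq_single (n, 0)]
  · rw [PowerSeries.coeff_zero_eq_constantCoeff_apply, PowerSeries.constantCoeff_expand,
      ← PowerSeries.coeff_zero_eq_constantCoeff_apply, hQ, mul_one]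
  · rintro ⟨i, j⟩ hij hne
    rw [Finset.HasAntidiagonal.mem_antidiagonal] at hij
    simp only at hij
    rw [PowerSeries.coeff_expand_of_not_dvd, mul_zero]
    intro hdvd
    have hj : j ≠ 0 := by
      rintro rfl
      exact hne (Prod.ext hij rfl)
    have := Nat.le_of_dvd (Nat.pos_of_ne_zero hj) hdvd
    omega
  · simp

end Evaluation

section Limit

open Filter Topology

/-- The geometric series `∑ qⁿ Xⁿ`. -/
noncomputable def geometricSeries (q : ℝ) : PowerSeries ℝ := PowerSeries.mk fun n => q ^ n

theorem one_sub_mul_geometricSeries (q : ℝ) :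
    (1 - PowerSeries.C q * PowerSeries.X) * geometricSeries q = 1 := by
  ext n
  rw [sub_mul, one_mul, mul_assoc, map_sub, PowerSeries.coeff_C_mul, geometricSeries]
  rcases n with _ | n
  · simp
  · rw [PowerSeries.coeff_succ_X_mul]
    simp [PowerSeries.coeff_one, pow_succ']

theorem one_sub_mul_expand_geometricSeries (q : ℝ) :
    (1 - PowerSeries.C q * PowerSeries.X ^ 2) *
      PowerSeries.expand 2 two_ne_zero (geometricSeries q) = 1 := by
  have h := congrArg (PowerSeries.expand 2 two_ne_zero) (one_sub_mul_geometricSeries q)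
  rwa [map_mul, map_sub, map_one, map_mul, PowerSeries.expand_C, PowerSeries.expand_X] at h

theorem hasSum_coeff_geometricSeries {q t : ℝ} (h : |q * t| < 1) :
    HasSum (fun n => PowerSeries.coeff n (geometricSeries q) * t ^ n) (1 - q * t)⁻¹ := by
  simpa [geometricSeries, mul_pow] using hasSum_geometric_of_abs_lt_one h

/-- The even coefficients of a power series, summed with geometric weights. -/
theorem coeff_two_mul_expand_geometricSeries_mul {q : ℝ} (hq : q ≠ 0) (A : PowerSeries ℝ) (n : ℕ) :
    PowerSeries.coeff (2 * n) (PowerSeries.expand 2 two_ne_zero (geometricSeries q) * A) / q ^ n =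
      ∑ m ∈ Finset.range (n + 1), PowerSeries.coeff (2 * m) A * q⁻¹ ^ m := by
  set E := PowerSeries.expand 2 two_ne_zero (geometricSeries q) * A with hE
  have hA : A = E - PowerSeries.C q * (PowerSeries.X ^ 2 * E) := by
    have := congrArg (· * A) (one_sub_mul_expand_geometricSeries q)
    simp only [one_mul] at this
    nth_rewrite 1 [← this]
    rw [hE]
    ring
  induction n with
  | zero =>
    rw [Finset.sum_range_one, hA, map_sub, PowerSeries.coeff_C_mul, PowerSeries.coeff_X_pow_mul']
    simp
  | succ n ih =>
    rw [Finset.sum_range_succ, ← ih]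
    have h : PowerSeries.coeff (2 * (n + 1)) A = PowerSeries.coeff (2 * (n + 1)) E -
        q * PowerSeries.coeff (2 * n) E := by
      nth_rewrite 1 [hA]
      rw [map_sub, PowerSeries.coeff_C_mul]
      congr 2
      exact PowerSeries.coeff_X_pow_mul E 2 (2 * n)
    rw [h, inv_pow]
    field_simp
    ring

/-- The truncated product `∏ (1 + Xᵏ)ᶠ ∏ (1 - q X²ᵏ)⁻¹`, without the factor `(1 - q X²)⁻¹`. -/
noncomputable def truncatedProduct (q : ℝ) (f N : ℕ) : PowerSeries ℝ :=
  (∏ k ∈ Finset.range (N + 1),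
      PowerSeries.expand (k + 1) k.succ_ne_zero ((1 + PowerSeries.X) ^ f)) *
    ∏ k ∈ Finset.range N, PowerSeries.expand (k + 2) (k + 1).succ_ne_zero
      (PowerSeries.expand 2 two_ne_zero (geometricSeries q))

theorem truncatedProduct_succ (q : ℝ) (f N : ℕ) :
    truncatedProduct q f (N + 1) = truncatedProduct q f N *
      PowerSeries.expand (N + 2) (N + 1).succ_ne_zero
        ((1 + PowerSeries.X) ^ f * PowerSeries.expand 2 two_ne_zero (geometricSeries q)) := by
  rw [truncatedProduct, Finset.prod_range_succ _ (N + 1), Finset.prod_range_succ (fun k =>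
    PowerSeries.expand (k + 2) (k + 1).succ_ne_zero
      (PowerSeries.expand 2 two_ne_zero (geometricSeries q))) N, map_mul]
  exact mul_mul_mul_comm _ _ _ _

theorem prod_expand_eq_mul_truncatedProduct (q : ℝ) (f N : ℕ) :
    ∏ k ∈ Finset.range (N + 1), PowerSeries.expand (k + 1) k.succ_ne_zero
        ((1 + PowerSeries.X) ^ f * PowerSeries.expand 2 two_ne_zero (geometricSeries q)) =
      PowerSeries.expand 2 two_ne_zero (geometricSeries q) * truncatedProduct q f N := by
  simp_rw [map_mul]
  rw [Finset.prod_mul_distrib, Finset.prod_range_succ' (fun k =>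
    PowerSeries.expand (k + 1) k.succ_ne_zero
      (PowerSeries.expand 2 two_ne_zero (geometricSeries q))) N, truncatedProduct]
  have h : PowerSeries.expand (0 + 1) (Nat.succ_ne_zero 0)
      (PowerSeries.expand 2 two_ne_zero (geometricSeries q)) =
        PowerSeries.expand 2 two_ne_zero (geometricSeries q) :=
    PowerSeries.expand_one_apply _
  rw [h]
  ring

theorem coeff_one_add_X_pow_nonneg (f n : ℕ) :
    0 ≤ PowerSeries.coeff n ((1 + PowerSeries.X : PowerSeries ℝ) ^ f) := by
  induction f generalizing n with
  | zero =>
    rw [pow_zero, PowerSeries.coeff_one]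
    split_ifs <;> norm_num
  | succ f ih =>
    rw [pow_succ]
    refine coeff_mul_nonneg ih (fun n => ?_) n
    rw [map_add, PowerSeries.coeff_one, PowerSeries.coeff_X]
    split_ifs <;> norm_num

theorem coeff_factor_nonneg {q : ℝ} (hq : 0 ≤ q) (f n : ℕ) :
    0 ≤ PowerSeries.coeff n
      ((1 + PowerSeries.X) ^ f * PowerSeries.expand 2 two_ne_zero (geometricSeries q)) :=
  coeff_mul_nonneg (coeff_one_add_X_pow_nonneg f) (coeff_expand_nonneg (fun n => by
    rw [geometricSeries, PowerSeries.coeff_mk]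
    exact pow_nonneg hq n) _) n

theorem coeff_zero_factor (q : ℝ) (f : ℕ) :
    PowerSeries.coeff 0
      ((1 + PowerSeries.X) ^ f * PowerSeries.expand 2 two_ne_zero (geometricSeries q)) = 1 := by
  simp [geometricSeries]

theorem coeff_truncatedProduct_nonneg {q : ℝ} (hq : 0 ≤ q) (f N n : ℕ) :
    0 ≤ PowerSeries.coeff n (truncatedProduct q f N) := by
  induction N generalizing n with
  | zero =>
    rw [truncatedProduct, Finset.prod_range_one, Finset.prod_range_zero, mul_one]
    exact coeff_expand_nonneg (coeff_one_add_X_pow_nonneg f) _ n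
  | succ N ih =>
    rw [truncatedProduct_succ]
    exact coeff_mul_nonneg ih (coeff_expand_nonneg (coeff_factor_nonneg hq f) _) n

theorem coeff_truncatedProduct_le_succ {q : ℝ} (hq : 0 ≤ q) (f N n : ℕ) :
    PowerSeries.coeff n (truncatedProduct q f N) ≤
      PowerSeries.coeff n (truncatedProduct q f (N + 1)) := by
  rw [truncatedProduct_succ]
  refine coeff_le_coeff_mul (coeff_truncatedProduct_nonneg hq f N)
    (coeff_expand_nonneg (coeff_factor_nonneg hq f) _) ?_ n
  rw [PowerSeries.coeff_zero_eq_constantCoeff_apply, PowerSeries.constantCoeff_expand,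
    ← PowerSeries.coeff_zero_eq_constantCoeff_apply, coeff_zero_factor]

theorem coeff_truncatedProduct_succ_of_le (q : ℝ) (f : ℕ) {N n : ℕ} (h : n ≤ N) :
    PowerSeries.coeff n (truncatedProduct q f (N + 1)) =
      PowerSeries.coeff n (truncatedProduct q f N) := by
  rw [truncatedProduct_succ]
  exact coeff_mul_expand_of_lt (coeff_zero_factor q f) _ (by omega)

theorem coeff_truncatedProduct_of_le (q : ℝ) (f : ℕ) {N n : ℕ} (h : n ≤ N) :
    PowerSeries.coeff n (truncatedProduct q f N) =
      PowerSeries.coeff n (truncatedProduct q f n) := by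
  induction N, h using Nat.le_induction with
  | base => rfl
  | succ N h ih => rw [coeff_truncatedProduct_succ_of_le q f h, ih]

theorem hasSum_coeff_truncatedProduct {q t : ℝ} (hq : 1 < q) (ht : t ^ 2 = q⁻¹) (f N : ℕ) :
    HasSum (fun n => PowerSeries.coeff n (truncatedProduct q f N) * t ^ n)
      ((∏ k ∈ Finset.range (N + 1), (1 + t ^ (k + 1)) ^ f) *
        ∏ k ∈ Finset.range N, (1 - q⁻¹ ^ (k + 1))⁻¹) := by
  refine hasSum_coeff_mul (hasSum_coeff_prod _ fun k _ => hasSum_coeff_expand _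
    (hasSum_coeff_pow (hasSum_coeff_one_add_X _) f)) (hasSum_coeff_prod _ fun k _ => ?_)
  have hk : q * ((t ^ (k + 2)) ^ 2) = q⁻¹ ^ (k + 1) := by
    rw [← pow_mul, mul_comm (k + 2), pow_mul, ht, pow_succ' _ (k + 1), ← mul_assoc,
      mul_inv_cancel₀ (by positivity), one_mul]
  refine hasSum_coeff_expand _ (hasSum_coeff_expand _ ?_)
  rw [← hk]
  refine hasSum_coeff_geometricSeries ?_
  rw [hk, abs_of_nonneg (by positivity)]
  exact pow_lt_one₀ (by positivity) (inv_lt_one_of_one_lt₀ hq) k.succ_ne_zero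

theorem summable_norm_pow_succ {x : ℝ} (hx : |x| < 1) : Summable fun i : ℕ => ‖x ^ (i + 1)‖ := by
  simp only [norm_pow]
  exact (summable_nat_add_iff 1).2 (summable_geometric_of_lt_one (norm_nonneg x) hx)

theorem tendsto_prod_one_add_pow {t : ℝ} (ht : |t| < 1) (f : ℕ) :
    Tendsto (fun N => ∏ k ∈ Finset.range N, (1 + t ^ (k + 1)) ^ f) atTop
      (𝓝 (∏' k : ℕ, (1 + t ^ (k + 1)) ^ f)) :=
  ((multipliable_one_add_of_summable (summable_norm_pow_succ ht)).pow f).tendsto_prod_tprod_nat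

theorem tendsto_prod_inv_one_sub_pow {x : ℝ} (hx : |x| < 1) :
    Tendsto (fun N => ∏ k ∈ Finset.range N, (1 - x ^ (k + 1))⁻¹) atTop
      (𝓝 (∏' k : ℕ, (1 - x ^ (k + 1)))⁻¹) := by
  have hs : Summable fun i : ℕ => ‖-x ^ (i + 1)‖ := by
    simpa only [norm_neg] using summable_norm_pow_succ hx
  have h0 : ∏' k : ℕ, (1 + -x ^ (k + 1)) ≠ 0 := by
    refine tprod_one_add_ne_zero_of_summable (fun i => ?_) hs
    have : |x ^ (i + 1)| < 1 := by
      rw [abs_pow]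
      exact pow_lt_one₀ (abs_nonneg x) hx i.succ_ne_zero
    rw [← sub_eq_add_neg, sub_ne_zero]
    exact (lt_of_abs_lt this).ne'
  have h := (multipliable_one_add_of_summable hs).tendsto_prod_tprod_nat.inv₀ h0
  simpa only [← sub_eq_add_neg, Finset.prod_inv_distrib] using h

theorem hasSum_coeff_truncatedProduct_diagonal {q t : ℝ} (hq : 1 < q) (ht : t ^ 2 = q⁻¹) (f : ℕ) :
    HasSum (fun n => PowerSeries.coeff n (truncatedProduct q f n) * t ^ n)
      ((∏' k : ℕ, (1 + t ^ (k + 1)) ^ f) * (∏' k : ℕ, (1 - q⁻¹ ^ (k + 1)))⁻¹) := by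
  have hq1 : |q⁻¹| < 1 := by
    rw [abs_of_nonneg (by positivity)]
    exact inv_lt_one_of_one_lt₀ hq
  have ht1 : |t| < 1 := by
    rw [← sq_lt_one_iff_abs_lt_one, ht]
    exact (le_abs_self _).trans_lt hq1
  have hlim {s : ℝ} (hs : |s| < 1) :=
    ((tendsto_prod_one_add_pow hs f).comp (tendsto_add_atTop_nat 1)).mul
      (tendsto_prod_inv_one_sub_pow hq1)
  have hq0 : 0 ≤ q := by linarith
  exact hasSum_coeff_of_stabilizing (coeff_truncatedProduct_nonneg hq0 f)
    (coeff_truncatedProduct_le_succ hq0 f)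
    (fun N n h => coeff_truncatedProduct_succ_of_le q f h)
    (hasSum_coeff_truncatedProduct hq ((sq_abs t).trans ht) f) (hlim ((abs_abs t).trans_lt ht1))
    (hasSum_coeff_truncatedProduct hq ht f) (hlim ht1)

theorem tendsto_coeff_expand_geometricSeries_mul {q t : ℝ} (hq : 1 < q) (ht : t ^ 2 = q⁻¹)
    (f : ℕ) :
    Tendsto (fun n => PowerSeries.coeff (2 * n) (PowerSeries.expand 2 two_ne_zero
        (geometricSeries q) * truncatedProduct q f (2 * n)) / q ^ n) atTop
      (𝓝 (1 / 2 * ((∏' k : ℕ, (1 + t ^ (k + 1)) ^ f) +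
        ∏' k : ℕ, (1 + (-1) ^ (k + 1) * t ^ (k + 1)) ^ f) / ∏' k : ℕ, (1 - q⁻¹ ^ (k + 1)))) := by
  have hpos := hasSum_coeff_truncatedProduct_diagonal hq ht f
  have hneg := hasSum_coeff_truncatedProduct_diagonal hq ((neg_sq t).trans ht) f
  have hsum := (hpos.add hneg).mul_left (1 / 2)
  rw [← Function.Injective.hasSum_iff (g := fun n => 2 * n)
    fun i j hij => Nat.eq_of_mul_eq_mul_left two_pos hij] at hsum
  · have hlim := (hsum.tendsto_sum_nat).comp (tendsto_add_atTop_nat 1)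
    convert hlim using 2 with n
    · rw [coeff_two_mul_expand_geometricSeries_mul (by positivity)]
      refine Finset.sum_congr rfl fun m hm => ?_
      rw [coeff_truncatedProduct_of_le q f
        (Nat.mul_le_mul_left 2 (Nat.lt_succ_iff.1 (Finset.mem_range.1 hm)))]
      simp only [Function.comp_apply, pow_mul, neg_sq, ht]
      ring
    · simp only [neg_pow t]
      ring
  · intro n hn
    have hodd : Odd n := by
      rw [← Nat.not_even_iff_odd]
      rintro ⟨m, rfl⟩
      exact hn ⟨m, two_mul m⟩
    rw [hodd.neg_pow]
    ring

end Limit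

theorem selfReciprocalSeries_eq {F : Type} [Field F] [Fintype F] [DecidableEq F] :
    selfReciprocalSeries F = (1 + PowerSeries.X) ^ (if (-1 : F) = 1 then 1 else 2) *
      PowerSeries.expand 2 two_ne_zero (geometricSeries (Fintype.card F)) := by
  rw [← one_sub_mul_selfReciprocalSeries, mul_right_comm, one_sub_mul_expand_geometricSeries,
    one_mul]

theorem neg_one_eq_one_iff_card_even {F : Type} [Field F] [Fintype F] :
    (-1 : F) = 1 ↔ Fintype.card F % 2 = 0 := by
  rw [← FiniteField.even_card_iff_char_two]
  constructor
  · intro h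
    by_contra h2
    exact Ring.neg_one_ne_one_of_char_ne_two h2 h
  · intro h
    have := ringChar.of_eq h
    exact CharTwo.neg_eq 1

theorem stmt16 (q : ℕ) (hq : IsPrimePow q)
    (F : Type) [Field F] [Fintype F] (hF : Fintype.card F = q)
    (f : ℕ) (hf : f = if q % 2 = 0 then 1 else 2) :
    Filter.Tendsto
      (fun n : ℕ =>
        (Nat.card (Quot (congRel (n := 2 * n) (F := F))) : ℝ) / (q : ℝ) ^ n)
      Filter.atTop
      (nhds
        ((1 / 2) *
          ((∏' i : ℕ, (1 + (Real.sqrt q)⁻¹ ^ (i + 1)) ^ f) +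
            ∏' i : ℕ, (1 + (-1 : ℝ) ^ (i + 1) * (Real.sqrt q)⁻¹ ^ (i + 1)) ^ f) /
          ∏' i : ℕ, (1 - (q : ℝ)⁻¹ ^ (i + 1)))) := by
  classical
  subst hF
  have hf' : f = if (-1 : F) = 1 then 1 else 2 := by
    simp only [hf, neg_one_eq_one_iff_card_even]
  have hcard : (1 : ℝ) < Fintype.card F := by exact_mod_cast hq.one_lt
  have hsq : (√(Fintype.card F : ℝ))⁻¹ ^ 2 = (Fintype.card F : ℝ)⁻¹ := by
    rw [inv_pow, Real.sq_sqrt (Nat.cast_nonneg _)]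
  refine (tendsto_coeff_expand_geometricSeries_mul hcard hsq f).congr fun n => ?_
  rw [← prod_expand_eq_mul_truncatedProduct, hf', ← selfReciprocalSeries_eq,
    ← natCard_quot_congRel_eq_coeff (Nat.le_succ _)]
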